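/- arXiv:0904.3979 — 2 statements merged into one kernel-verified Lean document; each statement's English description precedes it below -/
import Mathlib

section
/- Let k ≥ 5 be an integer. Let β_k be the cyclic permutation of P_k with β_k(1) = 3, β_k(3) = 2, β_k(2) = 4, β_k(i) = i+1 for 4 ≤ i ≤ k−1, and β_k(k) = 1 (the cycle 1→3→2→4→5→⋯→k→1), and let δ_k be the cyclic permutation of P_k with δ_k(1) = k, δ_k(i) = i−1 for 6 ≤ i ≤ k, δ_k(5) = 3, δ_k(3) = 2, δ_k(2) = 4, and δ_k(4) = 1 (the cycle 1→k→k−1→⋯→6→5→3→2→4→1). Then β_k and δ_k are right similar, but neither left similar nor two-sided similar; moreover the Petrie matrices M_{β_k} and M_{δ_k} are not similar over ℝ, since they have distinct traces. -/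
open Matrix

/-- `σ` is a permutation of `P_n = {1,…,n}`, viewed as a function `ℕ → ℕ`. -/
def IsPermOn (n : ℕ) (σ : ℕ → ℕ) : Prop :=
  Set.BijOn σ (Set.Icc 1 n) (Set.Icc 1 n)

/-- The Petrie matrix of a map `σ` on `P_n`: the `(n-1) × (n-1)` real matrix whose
`(i,j)` entry (with `1`-based indices) is `1` iff
`min (σ i) (σ (i+1)) ≤ j ≤ max (σ i) (σ (i+1)) - 1`, and `0` otherwise. -/
def petrie (n : ℕ) (σ : ℕ → ℕ) : Matrix (Fin (n - 1)) (Fin (n - 1)) ℝ :=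
  Matrix.of fun i j =>
    if min (σ (i.1 + 1)) (σ (i.1 + 2)) ≤ j.1 + 1 ∧
        j.1 + 1 ≤ max (σ (i.1 + 1)) (σ (i.1 + 2)) - 1 then 1 else 0

/-- Two square real matrices are similar if `B = P * A * P⁻¹` for some invertible `P`. -/
def MatSimilar {m : Type*} [Fintype m] [DecidableEq m] (A B : Matrix m m ℝ) : Prop :=
  ∃ P : Matrix m m ℝ, IsUnit P ∧ B = P * A * P⁻¹

/-- `σ'` (a permutation of `P_{k+n}`) is a right extension of `σ` (a permutation of `P_k`). -/
def IsRightExt (k n : ℕ) (σ σ' : ℕ → ℕ) : Prop :=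
  IsPermOn (k + n) σ' ∧
  (∀ i, 1 ≤ i → i ≤ k - 1 → σ' i = σ i) ∧
  ∃ t, k + 1 ≤ t ∧ t ≤ k + n ∧ σ' t = σ k ∧
    ∀ j, j ≠ t → k ≤ j → j ≤ k + n → k < σ' j

/-- `(σ', ρ')` is a synchronized right extension of `(σ, ρ)` to `P_{k+n}`. -/
def IsSyncRightExt (k n : ℕ) (σ ρ σ' ρ' : ℕ → ℕ) : Prop :=
  IsRightExt k n σ σ' ∧ IsRightExt k n ρ ρ' ∧
  ∃ t, k + 1 ≤ t ∧ t ≤ k + n ∧ σ' t = σ k ∧ ρ' t = ρ k ∧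
    ∀ i, i ≠ t → k ≤ i → i ≤ k + n → σ' i = ρ' i

/-- `σ'` (a permutation of `P_{m+k}`) is a left extension of `σ` (a permutation of `P_k`). -/
def IsLeftExt (k m : ℕ) (σ σ' : ℕ → ℕ) : Prop :=
  IsPermOn (m + k) σ' ∧
  (∀ i, 2 ≤ i → i ≤ k → σ' (m + i) = m + σ i) ∧
  ∃ s, 1 ≤ s ∧ s ≤ m ∧ σ' s = m + σ 1 ∧
    ∀ j, j ≠ s → 1 ≤ j → j ≤ m + 1 → σ' j < m + 1

/-- `(σ', ρ')` is a synchronized left extension of `(σ, ρ)` to `P_{m+k}`. -/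
def IsSyncLeftExt (k m : ℕ) (σ ρ σ' ρ' : ℕ → ℕ) : Prop :=
  IsLeftExt k m σ σ' ∧ IsLeftExt k m ρ ρ' ∧
  ∃ s, 1 ≤ s ∧ s ≤ m ∧ σ' s = m + σ 1 ∧ ρ' s = m + ρ 1 ∧
    ∀ i, i ≠ s → 1 ≤ i → i ≤ m + 1 → σ' i = ρ' i

/-- `σ'` (a permutation of `P_{m+k+n}`) is a two-sided extension of `σ` (a permutation of `P_k`). -/
def IsTwoSidedExt (k m n : ℕ) (σ σ' : ℕ → ℕ) : Prop :=
  IsPermOn (m + k + n) σ' ∧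
  (∀ i, 2 ≤ i → i ≤ k - 1 → σ' (m + i) = m + σ i) ∧
  (∃ s, 1 ≤ s ∧ s ≤ m ∧ σ' s = m + σ 1 ∧
    ∀ i, i ≠ s → 1 ≤ i → i ≤ m + 1 → σ' i < m + 1) ∧
  (∃ t, m + k + 1 ≤ t ∧ t ≤ m + k + n ∧ σ' t = m + σ k ∧
    ∀ j, j ≠ t → m + k ≤ j → j ≤ m + k + n → m + k < σ' j)

/-- `(σ', ρ')` is a synchronized two-sided extension of `(σ, ρ)` to `P_{m+k+n}`. -/
def IsSyncTwoSidedExt (k m n : ℕ) (σ ρ σ' ρ' : ℕ → ℕ) : Prop :=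
  IsTwoSidedExt k m n σ σ' ∧ IsTwoSidedExt k m n ρ ρ' ∧
  ∃ s t, 1 ≤ s ∧ s ≤ m ∧ m + k + 1 ≤ t ∧ t ≤ m + k + n ∧
    σ' s = m + σ 1 ∧ ρ' s = m + ρ 1 ∧ σ' t = m + σ k ∧ ρ' t = m + ρ k ∧
    ∀ i, i ≠ s → i ≠ t →
      ((1 ≤ i ∧ i ≤ m + 1) ∨ (m + k ≤ i ∧ i ≤ m + k + n)) → σ' i = ρ' i

/-- `σ` and `ρ` (permutations of `P_k`) are right similar. -/
def RightSimilar (k : ℕ) (σ ρ : ℕ → ℕ) : Prop :=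
  ∀ n, 1 ≤ n → ∀ σ' ρ' : ℕ → ℕ, IsSyncRightExt k n σ ρ σ' ρ' →
    MatSimilar (petrie (k + n) σ') (petrie (k + n) ρ')

/-- `σ` and `ρ` (permutations of `P_k`) are left similar. -/
def LeftSimilar (k : ℕ) (σ ρ : ℕ → ℕ) : Prop :=
  ∀ m, 1 ≤ m → ∀ σ' ρ' : ℕ → ℕ, IsSyncLeftExt k m σ ρ σ' ρ' →
    MatSimilar (petrie (m + k) σ') (petrie (m + k) ρ')

/-- `σ` and `ρ` (permutations of `P_k`) are two-sided similar. -/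
def TwoSidedSimilar (k : ℕ) (σ ρ : ℕ → ℕ) : Prop :=
  ∀ m n, 1 ≤ m → 1 ≤ n → ∀ σ' ρ' : ℕ → ℕ, IsSyncTwoSidedExt k m n σ ρ σ' ρ' →
    MatSimilar (petrie (m + k + n) σ') (petrie (m + k + n) ρ')

/-- `σ` and `ρ` (permutations of `P_k`) are right weakly similar. -/
def RightWeaklySimilar (k : ℕ) (σ ρ : ℕ → ℕ) : Prop :=
  ∀ n, 1 ≤ n → ∀ σ' ρ' : ℕ → ℕ, IsSyncRightExt k n σ ρ σ' ρ' →
    (petrie (k + n) σ').charpoly = (petrie (k + n) ρ').charpoly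

/-- The cyclic permutation `β_k : 1→3→2→4→5→⋯→k→1` of `P_k` (`k ≥ 5`). -/
def betaK (k : ℕ) : ℕ → ℕ := fun i =>
  if i = 1 then 3
  else if i = 3 then 2
  else if i = 2 then 4
  else if 4 ≤ i ∧ i ≤ k - 1 then i + 1
  else if i = k then 1
  else i

/-- The cyclic permutation `δ_k : 1→k→k-1→⋯→6→5→3→2→4→1` of `P_k` (`k ≥ 5`). -/
def deltaK (k : ℕ) : ℕ → ℕ := fun i =>
  if i = 1 then k
  else if 6 ≤ i ∧ i ≤ k then i - 1
  else if i = 5 then 3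
  else if i = 3 then 2
  else if i = 2 then 4
  else if i = 4 then 1
  else i


lemma trace_eq_of_similar {m : Type*} [Fintype m] [DecidableEq m] {A B : Matrix m m ℝ}
    (h : MatSimilar A B) : A.trace = B.trace := by
  obtain ⟨P, hP, rfl⟩ := h
  rw [Matrix.trace_mul_cycle, Matrix.nonsing_inv_mul _ ((Matrix.isUnit_iff_isUnit_det P).1 hP),
    Matrix.one_mul]

lemma det_eq_of_similar {m : Type*} [Fintype m] [DecidableEq m] {A B : Matrix m m ℝ}
    (h : MatSimilar A B) : A.det = B.det := by
  obtain ⟨P, hP, rfl⟩ := h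
  rw [Matrix.det_conj hP]

lemma petrie_trace (n : ℕ) (σ : ℕ → ℕ) :
    (petrie n σ).trace = (((Finset.range (n - 1)).filter fun i =>
      min (σ (i + 1)) (σ (i + 2)) ≤ i + 1 ∧
        i + 1 ≤ max (σ (i + 1)) (σ (i + 2)) - 1).card : ℝ) := by
  rw [← Finset.sum_boole, ← Fin.sum_univ_eq_sum_range (fun i => if
    min (σ (i + 1)) (σ (i + 2)) ≤ i + 1 ∧
        i + 1 ≤ max (σ (i + 1)) (σ (i + 2)) - 1 then (1 : ℝ) else 0)]
  rfl

lemma trace_beta (k : ℕ) (hk : 5 ≤ k) : (petrie k (betaK k)).trace = 3 := by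
  rw [petrie_trace]
  have : ((Finset.range (k - 1)).filter fun i =>
      min (betaK k (i + 1)) (betaK k (i + 2)) ≤ i + 1 ∧
        i + 1 ≤ max (betaK k (i + 1)) (betaK k (i + 2)) - 1) = {1, 2, k - 2} := by
    ext i
    rw [Finset.mem_filter, Finset.mem_range]
    simp only [Finset.mem_insert, Finset.mem_singleton, betaK]
    split_ifs <;> omega
  rw [this, Finset.card_insert_of_notMem, Finset.card_insert_of_notMem, Finset.card_singleton]
  · norm_num
  · simp; omega
  · simp; omega

lemma trace_delta (k : ℕ) (hk : 5 ≤ k) : (petrie k (deltaK k)).trace = 1 := by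
  rw [petrie_trace]
  have : ((Finset.range (k - 1)).filter fun i =>
      min (deltaK k (i + 1)) (deltaK k (i + 2)) ≤ i + 1 ∧
        i + 1 ≤ max (deltaK k (i + 1)) (deltaK k (i + 2)) - 1) = {1} := by
    ext i
    rw [Finset.mem_filter, Finset.mem_range]
    simp only [Finset.mem_singleton, deltaK]
    split_ifs <;> omega
  rw [this, Finset.card_singleton]
  norm_num

/-- A self-map of `{1,…,n}` that is injective is a permutation. -/
lemma isPermOn_of (n : ℕ) (σ : ℕ → ℕ) (h1 : ∀ i, 1 ≤ i → i ≤ n → 1 ≤ σ i ∧ σ i ≤ n)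
    (h2 : ∀ i j, 1 ≤ i → i ≤ n → 1 ≤ j → j ≤ n → σ i = σ j → i = j) : IsPermOn n σ := by
  have m : Set.MapsTo σ (Set.Icc 1 n) (Set.Icc 1 n) := fun i hi => h1 i hi.1 hi.2
  have inj : Set.InjOn σ (Set.Icc 1 n) := fun i hi j hj h => h2 i j hi.1 hi.2 hj.1 hj.2 h
  refine ⟨m, inj, ?_⟩
  have := Finset.surjOn_of_injOn_of_card_le (s := Finset.Icc 1 n) (t := Finset.Icc 1 n) σ
    (by simpa using m) (by simpa using inj) le_rfl
  simpa using this

/-- The left extension of `β_k` with `m = 1`. -/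
def betaL (k : ℕ) : ℕ → ℕ := fun i =>
  if i = 1 then 4 else if i = 2 then 1 else if i = 3 then 5 else if i = 4 then 3
  else if i ≤ k then i + 1 else 2

/-- The left extension of `δ_k` with `m = 1`. -/
def deltaL (k : ℕ) : ℕ → ℕ := fun i =>
  if i = 1 then k + 1 else if i = 2 then 1 else if i = 3 then 5 else if i = 4 then 3
  else if i = 5 then 2 else if i = 6 then 4 else i - 1

lemma trace_betaL (k : ℕ) (hk : 5 ≤ k) : (petrie (1 + k) (betaL k)).trace = 5 := by
  rw [petrie_trace]
  have : ((Finset.range (1 + k - 1)).filter fun i =>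
      min (betaL k (i + 1)) (betaL k (i + 2)) ≤ i + 1 ∧
        i + 1 ≤ max (betaL k (i + 1)) (betaL k (i + 2)) - 1) = {0, 1, 2, 3, k - 1} := by
    ext i
    rw [Finset.mem_filter, Finset.mem_range]
    simp only [Finset.mem_insert, Finset.mem_singleton, betaL]
    split_ifs <;> omega
  rw [this]
  repeat rw [Finset.card_insert_of_notMem (by simp <;> omega)]
  norm_num

lemma trace_deltaL (k : ℕ) (hk : 5 ≤ k) : (petrie (1 + k) (deltaL k)).trace = 3 := by
  rw [petrie_trace]
  have : ((Finset.range (1 + k - 1)).filter fun i =>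
      min (deltaL k (i + 1)) (deltaL k (i + 2)) ≤ i + 1 ∧
        i + 1 ≤ max (deltaL k (i + 1)) (deltaL k (i + 2)) - 1) = {0, 1, 2} := by
    ext i
    rw [Finset.mem_filter, Finset.mem_range]
    simp only [Finset.mem_insert, Finset.mem_singleton, deltaL]
    split_ifs <;> omega
  rw [this]
  norm_num

lemma not_left (k : ℕ) (hk : 5 ≤ k) : ¬ LeftSimilar k (betaK k) (deltaK k) := by
  intro h
  have hb : IsLeftExt k 1 (betaK k) (betaL k) := by
    refine ⟨isPermOn_of _ _ ?_ ?_, ?_, 1, le_rfl, le_rfl, ?_, ?_⟩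
    · simp only [betaL]; grind
    · simp only [betaL]; intro i j _ _ _ _ h; split_ifs at h <;> omega
    · simp only [betaL, betaK]; grind
    · simp only [betaL, betaK]; grind
    · simp only [betaL]; grind
  have hd : IsLeftExt k 1 (deltaK k) (deltaL k) := by
    refine ⟨isPermOn_of _ _ ?_ ?_, ?_, 1, le_rfl, le_rfl, ?_, ?_⟩
    · simp only [deltaL]; grind
    · simp only [deltaL]; intro i j _ _ _ _ h; split_ifs at h <;> omega
    · simp only [deltaL, deltaK]; grind
    · simp only [deltaL, deltaK]; grind
    · simp only [deltaL]; grind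
  have := trace_eq_of_similar (h 1 le_rfl (betaL k) (deltaL k) ⟨hb, hd, 1, le_rfl, le_rfl,
    by simp only [betaL, betaK]; grind, by simp only [deltaL, deltaK]; grind,
    by simp only [betaL, deltaL]; grind⟩)
  rw [trace_betaL k hk, trace_deltaL k hk] at this
  norm_num at this

/-- The signed version of the Petrie matrix. -/
def spet (n : ℕ) (σ : ℕ → ℕ) : Matrix (Fin (n - 1)) (Fin (n - 1)) ℝ :=
  Matrix.of fun i j => (if j.1 + 1 < σ (i.1 + 2) then (1 : ℝ) else 0) -
    (if j.1 + 1 < σ (i.1 + 1) then (1 : ℝ) else 0)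

lemma telescope (N : ℕ) (F : ℕ → ℝ) (b : ℕ) (hb : 1 ≤ b) (hbN : b ≤ N + 1) :
    ∑ l ∈ Finset.range N, (if l + 1 < b then (1 : ℝ) else 0) * (F (l + 2) - F (l + 1))
      = F b - F 1 := by
  obtain ⟨c, rfl⟩ : ∃ c, b = c + 1 := ⟨b - 1, by omega⟩
  simp only [add_lt_add_iff_right, ite_mul, one_mul, zero_mul]
  rw [← Finset.sum_filter]
  have : (Finset.range N).filter (fun l => l < c) = Finset.range c := by
    ext l; simp; omega
  rw [this, Finset.sum_range_sub (fun l => F (l + 1))]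

lemma spet_mul (n : ℕ) (hn : 1 ≤ n) (σ τ : ℕ → ℕ)
    (hσ : ∀ i, 1 ≤ i → i ≤ n → 1 ≤ σ i ∧ σ i ≤ n) :
    spet n σ * spet n τ = spet n (fun i => τ (σ i)) := by
  ext i j
  rw [Matrix.mul_apply]
  simp only [spet, Matrix.of_apply, sub_mul, Finset.sum_sub_distrib]
  have h1 := hσ (i.1 + 2) (by omega) (by omega)
  have h2 := hσ (i.1 + 1) (by omega) (by omega)
  have e1 := telescope (n - 1) (fun x => if j.1 + 1 < τ x then (1 : ℝ) else 0) _ h1.1 (by omega)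
  have e2 := telescope (n - 1) (fun x => if j.1 + 1 < τ x then (1 : ℝ) else 0) _ h2.1 (by omega)
  rw [← Fin.sum_univ_eq_sum_range (fun l => (if l + 1 < σ (i.1 + 2) then (1 : ℝ) else 0) *
    ((if j.1 + 1 < τ (l + 2) then (1 : ℝ) else 0) - (if j.1 + 1 < τ (l + 1) then (1 : ℝ) else 0)))]
    at e1
  rw [← Fin.sum_univ_eq_sum_range (fun l => (if l + 1 < σ (i.1 + 1) then (1 : ℝ) else 0) *
    ((if j.1 + 1 < τ (l + 2) then (1 : ℝ) else 0) - (if j.1 + 1 < τ (l + 1) then (1 : ℝ) else 0)))]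
    at e2
  rw [e1, e2]
  ring

lemma spet_congr (n : ℕ) (σ τ : ℕ → ℕ) (h : ∀ i, 1 ≤ i → i ≤ n → σ i = τ i) :
    spet n σ = spet n τ := by
  ext i j
  simp only [spet, Matrix.of_apply]
  rw [h (i.1 + 2) (by omega) (by omega), h (i.1 + 1) (by omega) (by omega)]

lemma spet_id (n : ℕ) : spet n (fun i => i) = 1 := by
  ext i j
  simp only [spet, Matrix.of_apply, Matrix.one_apply, Fin.ext_iff]
  grind

lemma spet_det_ne (n : ℕ) (hn : 1 ≤ n) (σ : ℕ → ℕ) (h : IsPermOn n σ) : (spet n σ).det ≠ 0 := by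
  have h1 : spet n σ * spet n (Function.invFunOn σ (Set.Icc 1 n)) = 1 := by
    rw [spet_mul n hn _ _ (fun i a b => h.1 ⟨a, b⟩), ← spet_id]
    apply spet_congr
    intro i a b
    exact h.2.1.leftInvOn_invFunOn ⟨a, b⟩
  intro h0
  have := congrArg Matrix.det h1
  rw [Matrix.det_mul, h0] at this
  simp at this

lemma petrie_eq (n : ℕ) (σ : ℕ → ℕ) (h : IsPermOn n σ) :
    petrie n σ = Matrix.diagonal
      (fun i : Fin (n - 1) => if σ (i.1 + 1) < σ (i.1 + 2) then (1 : ℝ) else -1) * spet n σ := by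
  ext i j
  simp only [petrie, spet, Matrix.diagonal_mul, Matrix.of_apply]
  have a := h.1 (show i.1 + 1 ∈ Set.Icc 1 n from ⟨by omega, by omega⟩)
  have b := h.1 (show i.1 + 2 ∈ Set.Icc 1 n from ⟨by omega, by omega⟩)
  have c := h.2.1 (show i.1 + 1 ∈ Set.Icc 1 n from ⟨by omega, by omega⟩)
    (show i.1 + 2 ∈ Set.Icc 1 n from ⟨by omega, by omega⟩)
  simp only [Set.mem_Icc] at a b
  by_cases hlt : σ (i.1 + 1) < σ (i.1 + 2)
  · rw [if_pos hlt]; split_ifs <;> first | (exfalso; omega) | norm_num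
  · have : σ (i.1 + 2) < σ (i.1 + 1) := by
      rcases Nat.lt_or_ge (σ (i.1 + 2)) (σ (i.1 + 1)) with h | h
      · exact h
      · have := c (by omega); omega
    rw [if_neg hlt]; split_ifs <;> first | (exfalso; omega) | norm_num

/-- The two-sided extension of `β_k` with `m = n = 1`. -/
def betaT (k : ℕ) : ℕ → ℕ := fun i =>
  if i = 1 then 4 else if i = 2 then 1 else if i = 3 then 5 else if i = 4 then 3
  else if i ≤ k + 1 then i + 1 else 2

/-- The two-sided extension of `δ_k` with `m = n = 1`. -/
def deltaT (k : ℕ) : ℕ → ℕ := fun i =>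
  if i = 1 then k + 1 else if i = 2 then 1 else if i = 3 then 5 else if i = 4 then 3
  else if i = 5 then 2 else if i = k + 1 then k + 2 
  else if i = k + 2 then (if k = 5 then 4 else k) else if i = 6 then 4 else i - 1

/-- A permutation conjugating `betaT k` to `deltaT k`. -/
def conjT (k : ℕ) : ℕ → ℕ := fun i =>
  if i = 1 then 1 else if i = 2 then 2 else if i = 3 then k + 2 else if i = 4 then k + 1
  else if i = k then 4 else if i = k + 1 then 3 else if i = k + 2 then 5 else k + 5 - i

lemma perm_betaT (k : ℕ) (hk : 5 ≤ k) : IsPermOn (1 + k + 1) (betaT k) := by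
  apply isPermOn_of
  · simp only [betaT]; intro i _ _; split_ifs <;> omega
  · simp only [betaT]; intro i j _ _ _ _ h; split_ifs at h <;> omega

set_option maxHeartbeats 2000000 in
lemma perm_deltaT (k : ℕ) (hk : 5 ≤ k) : IsPermOn (1 + k + 1) (deltaT k) := by
  apply isPermOn_of
  · simp only [deltaT]; intro i _ _; split_ifs <;> omega
  · simp only [deltaT]; intro i j _ _ _ _ h; grind (splits := 40)

set_option maxHeartbeats 2000000 in
lemma perm_conjT (k : ℕ) (hk : 5 ≤ k) : IsPermOn (1 + k + 1) (conjT k) := by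
  apply isPermOn_of
  · simp only [conjT]; intro i _ _; split_ifs <;> omega
  · simp only [conjT]; intro i j _ _ _ _ h; grind (splits := 40)

lemma det_spet_T (k : ℕ) (hk : 5 ≤ k) :
    (spet (1 + k + 1) (betaT k)).det = (spet (1 + k + 1) (deltaT k)).det := by
  have h : spet (1 + k + 1) (conjT k) * spet (1 + k + 1) (deltaT k) =
      spet (1 + k + 1) (betaT k) * spet (1 + k + 1) (conjT k) := by
    rw [spet_mul _ (by omega) _ _ (fun i a b => (perm_conjT k hk).1 ⟨a, b⟩),
      spet_mul _ (by omega) _ _ (fun i a b => (perm_betaT k hk).1 ⟨a, b⟩)]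
    apply spet_congr
    intro i h1 h2
    simp only [betaT, deltaT, conjT]
    grind (splits := 40)
  have := congrArg Matrix.det h
  rw [Matrix.det_mul, Matrix.det_mul, mul_comm] at this
  exact (mul_right_cancel₀ (spet_det_ne _ (by omega) _ (perm_conjT k hk)) this).symm

lemma not_twoSided (k : ℕ) (hk : 5 ≤ k) : ¬ TwoSidedSimilar k (betaK k) (deltaK k) := by
  intro h
  have hb : IsTwoSidedExt k 1 1 (betaK k) (betaT k) := by
    refine ⟨perm_betaT k hk, ?_, ⟨1, le_rfl, le_rfl, ?_, ?_⟩, 1 + k + 1, le_rfl, le_rfl, ?_, ?_⟩ <;>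
    (simp only [betaT, betaK]; grind (splits := 40))
  have hd : IsTwoSidedExt k 1 1 (deltaK k) (deltaT k) := by
    refine ⟨perm_deltaT k hk, ?_, ⟨1, le_rfl, le_rfl, ?_, ?_⟩, 1 + k + 1, le_rfl, le_rfl, ?_, ?_⟩ <;>
    (simp only [deltaT, deltaK]; grind (splits := 40))
  have := det_eq_of_similar (h 1 1 le_rfl le_rfl (betaT k) (deltaT k) ⟨hb, hd, 1, 1 + k + 1,
    le_rfl, le_rfl, le_rfl, le_rfl,
    by simp only [betaT, betaK]; grind (splits := 40), by simp only [deltaT, deltaK]; grind (splits := 40),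
    by simp only [betaT, betaK]; grind (splits := 40), by simp only [deltaT, deltaK]; grind (splits := 40),
    by simp only [betaT, deltaT]; grind (splits := 40)⟩)
  rw [petrie_eq _ _ (perm_betaT k hk), petrie_eq _ _ (perm_deltaT k hk), Matrix.det_mul,
    Matrix.det_mul, det_spet_T k hk, Matrix.det_diagonal, Matrix.det_diagonal] at this
  have h0 := mul_right_cancel₀ (spet_det_ne _ (by omega) _ (perm_deltaT k hk)) this
  have key : ∀ i : Fin (1 + k + 1 - 1),
      (if deltaT k (i.1 + 1) < deltaT k (i.1 + 2) then (1 : ℝ) else -1) =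
      (if betaT k (i.1 + 1) < betaT k (i.1 + 2) then (1 : ℝ) else -1) *
        (if i = ⟨3, by omega⟩ then -1 else 1) := by
    intro i
    have hi := i.2
    simp only [Fin.ext_iff]
    have e : (deltaT k (i.1 + 1) < deltaT k (i.1 + 2)) ↔
        (betaT k (i.1 + 1) < betaT k (i.1 + 2) ∧ i.1 ≠ 3) := by
      simp only [deltaT, betaT]; grind (splits := 40)
    have e3 : i.1 = 3 → betaT k (i.1 + 1) < betaT k (i.1 + 2) := by
      simp only [betaT]; grind
    by_cases h3 : i.1 = 3
    · have := e3 h3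
      have e' : ¬ (deltaT k (i.1 + 1) < deltaT k (i.1 + 2)) := fun h => (e.1 h).2 h3
      rw [if_neg e', if_pos this, if_pos h3, one_mul]
    · simp [e, h3]
  rw [Finset.prod_congr rfl (fun i _ => key i), Finset.prod_mul_distrib] at h0
  simp only [Finset.prod_ite_eq', Finset.mem_univ, if_true] at h0
  have hne : ∏ i : Fin (1 + k + 1 - 1),
      (if betaT k (i.1 + 1) < betaT k (i.1 + 2) then (1 : ℝ) else -1) ≠ 0 := by
    apply Finset.prod_ne_zero_iff.2
    intro i _
    split_ifs <;> norm_num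
  apply hne
  linarith

/-- The function `σ` on `{1,…,k-1}`, with the value at `k` replaced by `k`. -/
def cl (k : ℕ) (σ : ℕ → ℕ) : ℕ → ℕ := fun i => if i < k then σ i else k

/-- The splitting of the index set into the first `k-1` indices and the rest. -/
def splitEquiv (k n : ℕ) (hk : 1 ≤ k) : Fin (k - 1) ⊕ Fin n ≃ Fin (k + n - 1) :=
  finSumFinEquiv.trans (finCongr (by omega))

lemma splitEquiv_inl (k n : ℕ) (hk : 1 ≤ k) (i : Fin (k - 1)) :
    (splitEquiv k n hk (Sum.inl i)).1 = i.1 := by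
  simp [splitEquiv]

lemma splitEquiv_inr (k n : ℕ) (hk : 1 ≤ k) (i : Fin n) :
    (splitEquiv k n hk (Sum.inr i)).1 = k - 1 + i.1 := by
  simp [splitEquiv]

lemma similar_of_intertwine {m : Type*} [Fintype m] [DecidableEq m] {A B P : Matrix m m ℝ}
    (hP : IsUnit P) (h : B * P = P * A) : MatSimilar A B := by
  refine ⟨P, hP, ?_⟩
  rw [← h, Matrix.mul_assoc, Matrix.mul_nonsing_inv _ ((Matrix.isUnit_iff_isUnit_det P).1 hP),
    Matrix.mul_one]

/-- Block decomposition of the Petrie matrix of a right extension. -/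
lemma petrie_blocks (k n t : ℕ) (hk : 3 ≤ k) (σ σ' : ℕ → ℕ)
    (hσ : ∀ i, 1 ≤ i → i ≤ k → 1 ≤ σ i ∧ σ i ≤ k)
    (h1 : ∀ i, 1 ≤ i → i ≤ k - 1 → σ' i = σ i) (ht : k + 1 ≤ t) (htt : σ' t = σ k)
    (h2 : ∀ j, j ≠ t → k ≤ j → j ≤ k + n → k < σ' j) :
    (petrie (k + n) σ').submatrix (splitEquiv k n (by omega)) (splitEquiv k n (by omega)) =
      Matrix.fromBlocks (petrie k (cl k σ))
        (Matrix.of fun i j => if i.1 + 2 = k ∧ k + j.1 + 1 ≤ σ' k then 1 else 0)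
        (Matrix.of fun i j => (if k + i.1 = t ∨ k + i.1 + 1 = t then (1 : ℝ) else 0) *
          (if σ k ≤ j.1 + 1 then 1 else 0))
        (Matrix.of fun i j => if min (σ' (k + i.1)) (σ' (k + i.1 + 1)) ≤ k + j.1 ∧
          k + j.1 ≤ max (σ' (k + i.1)) (σ' (k + i.1 + 1)) - 1 then 1 else 0) := by
  have hk2 := h2 k (by omega) le_rfl (by omega)
  ext i j
  rcases i with i | i <;> rcases j with j | j
  · simp only [Matrix.submatrix_apply, Matrix.fromBlocks_apply₁₁, petrie, Matrix.of_apply,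
      splitEquiv_inl]
    have hi := i.2
    have hj := j.2
    have a1 := h1 (i.1 + 1) (by omega) (by omega)
    have a2 := hσ (i.1 + 1) (by omega) (by omega)
    have a3 := hσ (i.1 + 2) (by omega) (by omega)
    by_cases hik : i.1 + 2 = k
    · have e1 : cl k σ (i.1 + 1) = σ (i.1 + 1) := by simp only [cl]; rw [if_pos (by omega)]
      have e2 : cl k σ (i.1 + 2) = k := by simp only [cl]; rw [if_neg (by omega)]
      rw [e1, e2, a1, hik]
      congr 1
      apply propext
      omega
    · have e1 : cl k σ (i.1 + 1) = σ (i.1 + 1) := by simp only [cl]; rw [if_pos (by omega)]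
      have e2 : cl k σ (i.1 + 2) = σ (i.1 + 2) := by simp only [cl]; rw [if_pos (by omega)]
      rw [e1, e2, a1, h1 (i.1 + 2) (by omega) (by omega)]
  · simp only [Matrix.submatrix_apply, Matrix.fromBlocks_apply₁₂, petrie, Matrix.of_apply,
      splitEquiv_inl, splitEquiv_inr]
    have hi := i.2
    have hj := j.2
    have a1 := h1 (i.1 + 1) (by omega) (by omega)
    have a2 := hσ (i.1 + 1) (by omega) (by omega)
    have a3 := hσ (i.1 + 2) (by omega) (by omega)
    congr 1
    apply propext
    by_cases hik : i.1 + 2 = k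
    · rw [a1, hik]; omega
    · rw [a1, h1 (i.1 + 2) (by omega) (by omega)]; omega
  · simp only [Matrix.submatrix_apply, Matrix.fromBlocks_apply₂₁, petrie, Matrix.of_apply,
      splitEquiv_inl, splitEquiv_inr]
    have hi := i.2
    have hj := j.2
    have e1 : k - 1 + i.1 + 1 = k + i.1 := by omega
    have e2 : k - 1 + i.1 + 2 = k + i.1 + 1 := by omega
    have a3 := hσ k (by omega) (by omega)
    rw [e1, e2]
    by_cases c1 : k + i.1 = t
    · have := h2 (k + i.1 + 1) (by omega) (by omega) (by omega)
      rw [if_pos (Or.inl c1), one_mul, c1, htt]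
      rw [c1] at this
      congr 1
      apply propext
      omega
    · have b1 := h2 (k + i.1) (by omega) (by omega) (by omega)
      by_cases c2 : k + i.1 + 1 = t
      · rw [if_pos (Or.inr c2), one_mul, c2, htt]
        congr 1
        apply propext
        omega
      · have b2 := h2 (k + i.1 + 1) (by omega) (by omega) (by omega)
        rw [if_neg (by omega), if_neg (by omega), zero_mul]
  · simp only [Matrix.submatrix_apply, Matrix.fromBlocks_apply₂₂, petrie, Matrix.of_apply,
      splitEquiv_inr]
    have e1 : k - 1 + i.1 + 1 = k + i.1 := by omega
    have e2 : k - 1 + i.1 + 2 = k + i.1 + 1 := by omega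
    have e3 : k - 1 + j.1 + 1 = k + j.1 := by omega
    rw [e1, e2, e3]

/-- The criterion for right similarity. -/
lemma right_of_block (k : ℕ) (hk : 3 ≤ k) (σ ρ : ℕ → ℕ)
    (hσ : ∀ i, 1 ≤ i → i ≤ k → 1 ≤ σ i ∧ σ i ≤ k)
    (hρ : ∀ i, 1 ≤ i → i ≤ k → 1 ≤ ρ i ∧ ρ i ≤ k)
    (R : Matrix (Fin (k - 1)) (Fin (k - 1)) ℝ) (hR : IsUnit R)
    (hN : petrie k (cl k ρ) * R = R * petrie k (cl k σ))
    (hf : ∀ i j : Fin (k - 1), j.1 + 2 = k → R i j = if i.1 + 2 = k then 1 else 0)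
    (hu : ∀ j : Fin (k - 1), ∑ i : Fin (k - 1), (if ρ k ≤ i.1 + 1 then (1 : ℝ) else 0) * R i j =
      if σ k ≤ j.1 + 1 then 1 else 0) : RightSimilar k σ ρ := by
  rintro n hn σ' ρ' ⟨⟨-, hσ1, t1, ht1, ht1', hσt1, hσ2⟩, ⟨-, hρ1, t2, ht2, ht2', hρt2, hρ2⟩,
    t, ht, htn, hσt, hρt, hst⟩
  have a1 := hσ k (by omega) le_rfl
  have a2 := hρ k (by omega) le_rfl
  have q1 : t = t1 := by
    by_contra hne
    have := hσ2 t hne (by omega) (by omega)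
    omega
  have q2 : t = t2 := by
    by_contra hne
    have := hρ2 t hne (by omega) (by omega)
    omega
  subst q1
  subst q2
  have bσ := petrie_blocks k n t hk σ σ' hσ hσ1 ht hσt hσ2
  have bρ := petrie_blocks k n t hk ρ ρ' hρ hρ1 ht hρt hρ2
  set e := splitEquiv k n (by omega) with he
  have hP : IsUnit (Matrix.fromBlocks R 0 0 (1 : Matrix (Fin n) (Fin n) ℝ)) := by
    rw [Matrix.isUnit_iff_isUnit_det, Matrix.det_fromBlocks_zero₂₁, Matrix.det_one, mul_one]
    exact (Matrix.isUnit_iff_isUnit_det R).1 hR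
  have key : (petrie (k + n) ρ').submatrix e e *
      Matrix.fromBlocks R 0 0 (1 : Matrix (Fin n) (Fin n) ℝ) =
      Matrix.fromBlocks R 0 0 (1 : Matrix (Fin n) (Fin n) ℝ) *
        (petrie (k + n) σ').submatrix e e := by
    rw [bσ, bρ, Matrix.fromBlocks_multiply, Matrix.fromBlocks_multiply]
    simp only [Matrix.mul_zero, Matrix.zero_mul, add_zero, zero_add, Matrix.mul_one,
      Matrix.one_mul]
    rw [hN]
    congr 1
    · ext i j
      rw [Matrix.mul_apply, Finset.sum_eq_single (⟨k - 2, by omega⟩ : Fin (k - 1))]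
      · rw [hf i _ (by simp only []; omega), ← hst k (by omega) le_rfl (by omega)]
        simp only [Matrix.of_apply]
        by_cases c : i.1 + 2 = k
        · simp [c, show k - 2 + 2 = k by omega]
        · simp [c]
      · intro b _ hb
        have : b.1 + 2 ≠ k := by
          intro h; apply hb; ext; simp only []; omega
        simp [this]
      · simp
    · ext i j
      rw [Matrix.mul_apply]
      simp only [Matrix.of_apply, mul_assoc]
      rw [← Finset.mul_sum, hu j]
    · ext i j
      have hi := i.2
      simp only [Matrix.of_apply]
      congr 1
      apply propext
      by_cases c1 : k + i.1 = t
      · rw [c1, hσt, hρt, hst (t + 1) (by omega) (by omega) (by omega)]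
        omega
      · rw [hst (k + i.1) c1 (by omega) (by omega)]
        by_cases c2 : k + i.1 + 1 = t
        · rw [c2, hσt, hρt]; omega
        · rw [hst (k + i.1 + 1) c2 (by omega) (by omega)]
  have hP' : IsUnit ((Matrix.fromBlocks R 0 0 (1 : Matrix (Fin n) (Fin n) ℝ)).submatrix
      e.symm e.symm) := by
    rw [Matrix.isUnit_iff_isUnit_det, Matrix.det_submatrix_equiv_self]
    exact (Matrix.isUnit_iff_isUnit_det _).1 hP
  apply similar_of_intertwine hP'
  have := congrArg (fun M => M.submatrix e.symm e.symm) key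
  rw [← Matrix.submatrix_mul_equiv _ _ e.symm e.symm e.symm,
    ← Matrix.submatrix_mul_equiv _ _ e.symm e.symm e.symm] at this
  simpa [Matrix.submatrix_submatrix] using this

lemma beta_range (k : ℕ) (hk : 5 ≤ k) : ∀ i, 1 ≤ i → i ≤ k → 1 ≤ betaK k i ∧ betaK k i ≤ k := by
  intro i _ _
  simp only [betaK]
  split_ifs <;> omega

lemma delta_range (k : ℕ) (hk : 5 ≤ k) :
    ∀ i, 1 ≤ i → i ≤ k → 1 ≤ deltaK k i ∧ deltaK k i ≤ k := by
  intro i _ _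
  simp only [deltaK]
  split_ifs <;> omega

lemma beta_five : petrie 5 (cl 5 (betaK 5)) =
    (!![0, 0, 1, 0; 0, 1, 1, 0; 0, 1, 1, 1; 0, 0, 0, 0] : Matrix (Fin 4) (Fin 4) ℝ) := by
  ext i j
  fin_cases i <;> fin_cases j <;> simp [petrie, cl, betaK]

lemma delta_five : petrie 5 (cl 5 (deltaK 5)) =
    (!![0, 0, 0, 1; 0, 1, 1, 0; 1, 0, 0, 0; 1, 1, 1, 1] : Matrix (Fin 4) (Fin 4) ℝ) := by
  ext i j
  fin_cases i <;> fin_cases j <;> simp [petrie, cl, deltaK]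

lemma beta_six : petrie 6 (cl 6 (betaK 6)) =
    (!![0, 0, 1, 0, 0; 0, 1, 1, 0, 0; 0, 1, 1, 1, 0; 0, 0, 0, 0, 1; 0, 0, 0, 0, 0] :
      Matrix (Fin 5) (Fin 5) ℝ) := by
  ext i j
  fin_cases i <;> fin_cases j <;> simp [petrie, cl, betaK]

lemma delta_six : petrie 6 (cl 6 (deltaK 6)) =
    (!![0, 0, 0, 1, 1; 0, 1, 1, 0, 0; 1, 0, 0, 0, 0; 1, 1, 0, 0, 0; 0, 0, 1, 1, 1] :
      Matrix (Fin 5) (Fin 5) ℝ) := by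
  ext i j
  fin_cases i <;> fin_cases j <;> simp [petrie, cl, deltaK]

set_option maxHeartbeats 2000000 in
lemma right_five : RightSimilar 5 (betaK 5) (deltaK 5) := by
  refine right_of_block 5 (by norm_num) _ _ (beta_range 5 le_rfl) (delta_range 5 le_rfl)
    (!![0, 0, 1, 0; -1, 1, 0, 0; 1, 0, 0, 0; 0, 1, 1, 1] : Matrix (Fin 4) (Fin 4) ℝ) ?_ ?_ ?_ ?_
  · apply IsUnit.of_mul_eq_one
      (!![0, 0, 1, 0; 0, 1, 1, 0; 1, 0, 0, 0; -1, -1, -1, 1] : Matrix (Fin 4) (Fin 4) ℝ)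
    ext i j
    fin_cases i <;> fin_cases j <;> simp [Matrix.mul_apply, Fin.sum_univ_succ]
  · rw [beta_five, delta_five]
    ext i j
    fin_cases i <;> fin_cases j <;> norm_num [Matrix.mul_apply, Fin.sum_univ_succ]
  · intro i j
    fin_cases i <;> fin_cases j <;> simp
  · intro j
    fin_cases j <;> simp [Fin.sum_univ_succ, betaK, deltaK]

set_option maxHeartbeats 2000000 in
lemma right_six : RightSimilar 6 (betaK 6) (deltaK 6) := by
  refine right_of_block 6 (by norm_num) _ _ (beta_range 6 (by norm_num))
    (delta_range 6 (by norm_num))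
    (!![0, 1, 1, 1, 0; 0, 1, 0, 0, 0; 0, 0, 1, 0, 0; -1, 1, 1, 0, 0; 1, 1, 1, 1, 1] :
      Matrix (Fin 5) (Fin 5) ℝ) ?_ ?_ ?_ ?_
  · apply IsUnit.of_mul_eq_one
      (!![0, 1, 1, -1, 0; 0, 1, 0, 0, 0; 0, 0, 1, 0, 0; 1, -1, -1, 0, 0; -1, -1, -1, 1, 1] :
        Matrix (Fin 5) (Fin 5) ℝ)
    ext i j
    fin_cases i <;> fin_cases j <;> simp [Matrix.mul_apply, Fin.sum_univ_succ]
  · rw [beta_six, delta_six]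
    ext i j
    fin_cases i <;> fin_cases j <;> norm_num [Matrix.mul_apply, Fin.sum_univ_succ]
  · intro i j
    fin_cases i <;> fin_cases j <;> simp
  · intro j
    fin_cases j <;> simp [Fin.sum_univ_succ, betaK, deltaK]

/-- First row of the intertwiner. -/
def seqA : ℕ → ℝ
  | 0 => 0
  | 1 => 1
  | s + 2 => 2 ^ s

/-- Second row of the intertwiner. -/
def seqB : ℕ → ℝ
  | 0 => 0
  | 1 => 0
  | 2 => 0
  | s + 3 => 2 ^ s

/-- Third row of the intertwiner. -/
def seqC : ℕ → ℝ
  | 0 => 0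
  | 1 => 0
  | 2 => 1
  | s + 3 => 2 ^ s

/-- Fourth row of the intertwiner. -/
def seqD : ℕ → ℝ
  | 0 => 0
  | 1 => 0
  | 2 => 1
  | 3 => 1
  | s + 4 => 3 * 2 ^ s

/-- Fifth row of the intertwiner. -/
def seqG : ℕ → ℝ
  | 0 => 0
  | 1 => 0
  | 2 => 0
  | 3 => 2
  | 4 => 2
  | s + 5 => 5 * 2 ^ s

lemma seqB_succ (s : ℕ) : seqB (s + 1) = seqB s + seqC s := by
  rcases s with _ | _ | _ | s <;> norm_num [seqB, seqC] <;> ring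

lemma seqC_succ (s : ℕ) : seqC (s + 1) = seqA s := by
  rcases s with _ | _ | _ | s <;> norm_num [seqA, seqC]

lemma seqD_succ (s : ℕ) : seqD (s + 1) = seqA s + seqB s := by
  rcases s with _ | _ | _ | s <;> norm_num [seqA, seqB, seqD] <;> ring

lemma seqG_succ (s : ℕ) : seqG (s + 1) = seqC s + seqD s := by
  rcases s with _ | _ | _ | _ | s <;> norm_num [seqC, seqD, seqG] <;> ring

lemma seqG_small (s : ℕ) (h : s ≤ 2) : seqG s = 0 := by
  interval_cases s <;> rfl

lemma seqG_sum (s : ℕ) : ∀ K, s ≤ K + 2 →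
    ∑ x ∈ Finset.range K, seqG (s - x) = seqA (s + 1) - seqD s - 1 := by
  induction s with
  | zero =>
    intro K _
    rw [Finset.sum_eq_zero]
    · norm_num [seqA, seqD]
    · intro x _; exact seqG_small _ (by omega)
  | succ s ih =>
    intro K hK
    rcases K with _ | K
    · have : s ≤ 1 := by omega
      interval_cases s <;> norm_num [seqA, seqD]
    · rw [Finset.sum_range_succ']
      have : ∀ x, s + 1 - (x + 1) = s - x := fun x => by omega
      simp only [this]
      rw [ih K (by omega), Nat.sub_zero]
      rcases s with _ | _ | _ | _ | s <;> norm_num [seqA, seqD, seqG] <;> ring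

/-- Krylov vectors of `δ`. -/
def rowC (k s i : ℕ) : ℝ :=
  if i = k - 1 then 1 else if i = 1 then seqA s else if i = 2 then seqB s
  else if i = 3 then seqC s else if i = 4 then seqD s else seqG (s + 5 - i)

/-- The column `j = 1` of the intertwiner. -/
def colX (k i : ℕ) : ℝ := if i = k - 1 then 1 else if i = k - 2 then -1 else 0

/-- The correction in column `j = 2` of the intertwiner. -/
def colY (k i : ℕ) : ℝ := if i = k - 3 then 1 else if i = k - 2 then -1 else 0

/-- Entries of the intertwiner, with `1`-based indices. -/
def Rf (k i j : ℕ) : ℝ :=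
  if j = 1 then colX k i else if j = 2 then rowC k (k - 4) i + colY k i else rowC k (k - 1 - j) i

/-- The action of the block of `δ` on column vectors. -/
def opD (k : ℕ) (F : ℕ → ℝ) (i : ℕ) : ℝ :=
  if i = 1 then ∑ l ∈ Finset.Icc 4 (k - 1), F l else if i = 2 then F 2 + F 3
  else if i = 3 then F 1 else if i = 4 then F 1 + F 2 else if i = 5 then F 3 + F 4
  else if i = k - 1 then F (k - 2) + F (k - 1) else F (i - 1)

/-- The action of the block of `β` on row vectors. -/
def opBr (F : ℕ → ℝ) (j : ℕ) : ℝ :=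
  if j = 1 then 0 else if j = 2 then F 2 + F 3 else if j = 3 then F 1 + F 2 + F 3
  else F (j - 1)

/-- The action of the block of `β` on column vectors. -/
def opBc (F : ℕ → ℝ) (j : ℕ) : ℝ :=
  if j = 1 then F 3 else if j = 2 then F 2 + F 3 else if j = 3 then F 2 + F 3 + F 4
  else F (j + 1)

lemma sum_interval (N lo hi : ℕ) (p : ℕ → Prop) [DecidablePred p] (F : ℕ → ℝ)
    (h : ∀ l, 1 ≤ l → l ≤ N → (p l ↔ lo ≤ l ∧ l ≤ hi)) (hlo : 1 ≤ lo) (hhi : hi ≤ N) :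
    ∑ l : Fin N, (if p (l.1 + 1) then (1 : ℝ) else 0) * F (l.1 + 1) =
      ∑ l ∈ Finset.Icc lo hi, F l := by
  rw [Fin.sum_univ_eq_sum_range (fun l => (if p (l + 1) then (1 : ℝ) else 0) * F (l + 1)),
    Finset.range_eq_Ico, Finset.sum_Ico_add' (fun l => (if p l then (1 : ℝ) else 0) * F l)]
  simp only [ite_mul, one_mul, zero_mul]
  rw [← Finset.sum_filter]
  apply Finset.sum_congr _ (fun _ _ => rfl)
  ext l
  rw [Finset.mem_filter, Finset.mem_Ico, Finset.mem_Icc]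
  constructor
  · rintro ⟨h1, h2⟩
    exact (h l (by omega) (by omega)).1 h2
  · intro h1
    exact ⟨by omega, (h l (by omega) (by omega)).2 h1⟩

lemma sum_Icc_two (a : ℕ) (F : ℕ → ℝ) : ∑ l ∈ Finset.Icc a (a + 1), F l = F a + F (a + 1) := by
  rw [Finset.sum_Icc_succ_top (by omega), Finset.Icc_self, Finset.sum_singleton]

lemma cd (k : ℕ) (hk : 7 ≤ k) : cl k (deltaK k) 1 = k ∧ cl k (deltaK k) 2 = 4 ∧
    cl k (deltaK k) 3 = 2 ∧ cl k (deltaK k) 4 = 1 ∧ cl k (deltaK k) 5 = 3 ∧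
    cl k (deltaK k) k = k ∧ ∀ m, 6 ≤ m → m < k → cl k (deltaK k) m = m - 1 := by
  refine ⟨?_, ?_, ?_, ?_, ?_, ?_, ?_⟩
  · simp only [cl, deltaK]; rw [if_pos (by omega)]; simp
  · simp only [cl, deltaK]; rw [if_pos (by omega)]; simp
  · simp only [cl, deltaK]; rw [if_pos (by omega)]; simp
  · simp only [cl, deltaK]; rw [if_pos (by omega)]; simp
  · simp only [cl, deltaK]; rw [if_pos (by omega)]; simp
  · simp [cl]
  · intro m h1 h2
    simp only [cl, deltaK]
    rw [if_pos h2, if_neg (by omega), if_pos (by omega)]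

lemma cb (k : ℕ) (hk : 7 ≤ k) : cl k (betaK k) 1 = 3 ∧ cl k (betaK k) 2 = 4 ∧
    cl k (betaK k) 3 = 2 ∧
    cl k (betaK k) k = k ∧ ∀ m, 4 ≤ m → m < k → cl k (betaK k) m = m + 1 := by
  refine ⟨?_, ?_, ?_, ?_, ?_⟩
  · simp only [cl, betaK]; rw [if_pos (by omega)]; simp
  · simp only [cl, betaK]; rw [if_pos (by omega)]; simp
  · simp only [cl, betaK]; rw [if_pos (by omega)]; simp
  · simp [cl]
  · intro m h1 h2
    simp only [cl, betaK]
    rw [if_pos h2, if_neg (by omega), if_neg (by omega), if_neg (by omega), if_pos (by omega)]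

lemma delta_mul (k : ℕ) (hk : 7 ≤ k) (F : ℕ → ℝ) (i : Fin (k - 1)) :
    ∑ l : Fin (k - 1), petrie k (cl k (deltaK k)) i l * F (l.1 + 1) = opD k F (i.1 + 1) := by
  have hi := i.2
  obtain ⟨c1, c2, c3, c4, c5, ck, cm⟩ := cd k hk
  simp only [petrie, Matrix.of_apply]
  have S := fun lo hi => sum_interval (k - 1) lo hi (fun l =>
    min (cl k (deltaK k) (i.1 + 1)) (cl k (deltaK k) (i.1 + 2)) ≤ l ∧
    l ≤ max (cl k (deltaK k) (i.1 + 1)) (cl k (deltaK k) (i.1 + 2)) - 1) F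
  obtain h | h | h | h | h | h | h : i.1 = 0 ∨ i.1 = 1 ∨ i.1 = 2 ∨ i.1 = 3 ∨ i.1 = 4 ∨
      i.1 + 2 = k ∨ (5 ≤ i.1 ∧ i.1 + 2 < k) := by omega
  · rw [S 4 (k - 1) (by intro l _ _; rw [h, Nat.zero_add, Nat.zero_add, c1, c2]; omega) (by omega) (by omega)]
    simp [opD, h]
  · rw [S 2 3 (by intro l _ _; rw [show i.1 + 1 = 2 by omega, show i.1 + 2 = 3 by omega, c2, c3]; omega) (by omega) (by omega)]
    rw [sum_Icc_two 2]
    simp [opD, h]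
  · rw [S 1 1 (by intro l _ _; rw [show i.1 + 1 = 3 by omega, show i.1 + 2 = 4 by omega, c3, c4]; omega) (by omega) (by omega)]
    simp [opD, h]
  · rw [S 1 2 (by intro l _ _; rw [show i.1 + 1 = 4 by omega, show i.1 + 2 = 5 by omega, c4, c5]; omega) (by omega) (by omega)]
    rw [sum_Icc_two 1]
    simp [opD, h]
  · rw [S 3 4 (by intro l _ _; rw [show i.1 + 1 = 5 by omega, show i.1 + 2 = 6 by omega, c5, cm 6 (by omega) (by omega)]; omega) (by omega) (by omega)]
    rw [sum_Icc_two 3]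
    simp [opD, h]
  · rw [S (k - 2) (k - 2 + 1) (by intro l _ _; rw [show i.1 + 1 = k - 1 by omega, show i.1 + 2 = k by omega, ck, cm (k - 1) (by omega) (by omega)]; omega) (by omega)
      (by omega)]
    rw [sum_Icc_two (k - 2)]
    simp only [opD]
    rw [if_neg (by omega), if_neg (by omega), if_neg (by omega), if_neg (by omega),
      if_neg (by omega), if_pos (by omega), show k - 2 + 1 = k - 1 by omega]
  · rw [S i.1 i.1 (by intro l _ _; rw [cm (i.1 + 1) (by omega) (by omega), cm (i.1 + 2) (by omega) (by omega)]; omega) (by omega)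
      (by omega)]
    simp only [opD]
    rw [if_neg (by omega), if_neg (by omega), if_neg (by omega), if_neg (by omega),
      if_neg (by omega), if_neg (by omega)]
    simp

lemma beta_mul (k : ℕ) (hk : 7 ≤ k) (F : ℕ → ℝ) (hF : F k = 0) (i : Fin (k - 1)) :
    ∑ l : Fin (k - 1), petrie k (cl k (betaK k)) i l * F (l.1 + 1) = opBc F (i.1 + 1) := by
  have hi := i.2
  obtain ⟨c1, c2, c3, ck, cm⟩ := cb k hk
  simp only [petrie, Matrix.of_apply]
  have S := fun lo hi => sum_interval (k - 1) lo hi (fun l =>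
    min (cl k (betaK k) (i.1 + 1)) (cl k (betaK k) (i.1 + 2)) ≤ l ∧
    l ≤ max (cl k (betaK k) (i.1 + 1)) (cl k (betaK k) (i.1 + 2)) - 1) F
  obtain h | h | h | h | h : i.1 = 0 ∨ i.1 = 1 ∨ i.1 = 2 ∨
      i.1 + 2 = k ∨ (3 ≤ i.1 ∧ i.1 + 2 < k) := by omega
  · rw [S 3 3 (by intro l _ _; rw [h, Nat.zero_add, Nat.zero_add, c1, c2]; omega) (by omega) (by omega)]
    simp [opBc, h]
  · rw [S 2 3 (by intro l _ _; rw [show i.1 + 1 = 2 by omega, show i.1 + 2 = 3 by omega, c2, c3]; omega) (by omega) (by omega)]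
    rw [sum_Icc_two 2]
    simp [opBc, h]
  · rw [S 2 4 (by intro l _ _; rw [show i.1 + 1 = 3 by omega, show i.1 + 2 = 4 by omega, c3, cm 4 (by omega) (by omega)]; omega) (by omega) (by omega)]
    rw [Finset.sum_Icc_succ_top (by omega), sum_Icc_two 2]
    simp [opBc, h]
  · rw [S 2 1 (by intro l _ _; rw [show i.1 + 1 = k - 1 by omega, show i.1 + 2 = k by omega, ck, cm (k - 1) (by omega) (by omega)]; omega) (by omega)
      (by omega)]
    simp only [opBc]
    rw [if_neg (by omega), if_neg (by omega), if_neg (by omega), show i.1 + 1 + 1 = k by omega, hF]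
    simp
  · rw [S (i.1 + 2) (i.1 + 2) (by intro l _ _; rw [cm (i.1 + 1) (by omega) (by omega), cm (i.1 + 2) (by omega) (by omega)]; omega) (by omega)
      (by omega)]
    simp only [opBc]
    rw [if_neg (by omega), if_neg (by omega), if_neg (by omega)]
    simp

lemma mul_beta (k : ℕ) (hk : 7 ≤ k) (F : ℕ → ℝ) (j : Fin (k - 1)) :
    ∑ l : Fin (k - 1), F (l.1 + 1) * petrie k (cl k (betaK k)) l j = opBr F (j.1 + 1) := by
  have hj := j.2
  obtain ⟨c1, c2, c3, ck, cm⟩ := cb k hk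
  have V : ∀ l, 1 ≤ l → l ≤ k - 1 →
      (l = 1 ∧ cl k (betaK k) l = 3 ∧ cl k (betaK k) (l + 1) = 4) ∨
      (l = 2 ∧ cl k (betaK k) l = 4 ∧ cl k (betaK k) (l + 1) = 2) ∨
      (l = 3 ∧ cl k (betaK k) l = 2 ∧ cl k (betaK k) (l + 1) = 5) ∨
      (4 ≤ l ∧ l + 1 < k ∧ cl k (betaK k) l = l + 1 ∧ cl k (betaK k) (l + 1) = l + 2) ∨
      (l + 1 = k ∧ cl k (betaK k) l = k ∧ cl k (betaK k) (l + 1) = k) := by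
    intro l h1 h2
    obtain rfl | rfl | rfl | h | h : l = 1 ∨ l = 2 ∨ l = 3 ∨ (4 ≤ l ∧ l + 1 < k) ∨ l + 1 = k := by
      omega
    · exact Or.inl ⟨rfl, c1, c2⟩
    · exact Or.inr (Or.inl ⟨rfl, c2, c3⟩)
    · exact Or.inr (Or.inr (Or.inl ⟨rfl, c3, cm 4 (by omega) (by omega)⟩))
    · exact Or.inr (Or.inr (Or.inr (Or.inl ⟨h.1, h.2, cm l (by omega) (by omega),
        cm (l + 1) (by omega) (by omega)⟩)))
    · exact Or.inr (Or.inr (Or.inr (Or.inr ⟨h, by rw [cm l (by omega) (by omega), h],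
        by rw [h, ck]⟩)))
  simp only [petrie, Matrix.of_apply, mul_comm (F _)]
  have S := fun lo hi => sum_interval (k - 1) lo hi (fun l =>
    min (cl k (betaK k) l) (cl k (betaK k) (l + 1)) ≤ j.1 + 1 ∧
    j.1 + 1 ≤ max (cl k (betaK k) l) (cl k (betaK k) (l + 1)) - 1) F
  obtain h | h | h | h : j.1 = 0 ∨ j.1 = 1 ∨ j.1 = 2 ∨ 3 ≤ j.1 := by omega
  · rw [S 2 1 (by
      intro l h1 h2
      obtain ⟨_, e1, e2⟩ | ⟨_, e1, e2⟩ | ⟨_, e1, e2⟩ | ⟨_, _, e1, e2⟩ | ⟨_, e1, e2⟩ := V l h1 h2 <;>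
        rw [e1, e2] <;> omega) (by omega) (by omega)]
    simp [opBr, h]
  · rw [S 2 3 (by
      intro l h1 h2
      obtain ⟨_, e1, e2⟩ | ⟨_, e1, e2⟩ | ⟨_, e1, e2⟩ | ⟨_, _, e1, e2⟩ | ⟨_, e1, e2⟩ := V l h1 h2 <;>
        rw [e1, e2] <;> omega) (by omega) (by omega)]
    rw [sum_Icc_two 2]
    simp [opBr, h]
  · rw [S 1 3 (by
      intro l h1 h2
      obtain ⟨_, e1, e2⟩ | ⟨_, e1, e2⟩ | ⟨_, e1, e2⟩ | ⟨_, _, e1, e2⟩ | ⟨_, e1, e2⟩ := V l h1 h2 <;>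
        rw [e1, e2] <;> omega) (by omega) (by omega)]
    rw [Finset.sum_Icc_succ_top (by omega), sum_Icc_two 1]
    simp [opBr, h]
  · rw [S j.1 j.1 (by
      intro l h1 h2
      obtain ⟨_, e1, e2⟩ | ⟨_, e1, e2⟩ | ⟨_, e1, e2⟩ | ⟨_, _, e1, e2⟩ | ⟨_, e1, e2⟩ := V l h1 h2 <;>
        rw [e1, e2] <;> omega) (by omega)
      (by omega)]
    simp only [opBr]
    rw [if_neg (by omega), if_neg (by omega), if_neg (by omega)]
    simp

lemma rowC_last (k s : ℕ) : rowC k s (k - 1) = 1 := by simp [rowC]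

lemma rowC_mid (k s i : ℕ) (h : 5 ≤ i) (h2 : i ≠ k - 1) : rowC k s i = seqG (s + 5 - i) := by
  simp only [rowC]
  rw [if_neg h2, if_neg (by omega), if_neg (by omega), if_neg (by omega), if_neg (by omega)]

lemma rowC_one (k s : ℕ) (hk : 7 ≤ k) : rowC k s 1 = seqA s := by
  simp only [rowC]
  rw [if_neg (by omega)]; simp

lemma rowC_two (k s : ℕ) (hk : 7 ≤ k) : rowC k s 2 = seqB s := by
  simp only [rowC]
  rw [if_neg (by omega)]; simp

lemma rowC_three (k s : ℕ) (hk : 7 ≤ k) : rowC k s 3 = seqC s := by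
  simp only [rowC]
  rw [if_neg (by omega)]; simp

lemma rowC_four (k s : ℕ) (hk : 7 ≤ k) : rowC k s 4 = seqD s := by
  simp only [rowC]
  rw [if_neg (by omega)]; simp

lemma rowC_sum (k s : ℕ) (hk : 7 ≤ k) (hs : s + 4 ≤ k) :
    ∑ l ∈ Finset.Icc 4 (k - 1), rowC k s l = seqA (s + 1) := by
  obtain ⟨K, rfl⟩ : ∃ K, k = K + 6 := ⟨k - 6, by omega⟩
  have e : Finset.Icc 4 (K + 6 - 1) = Finset.Ico 4 (4 + (K + 2)) := by
    ext l; simp only [Finset.mem_Icc, Finset.mem_Ico]; omega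
  rw [e, Finset.sum_Ico_eq_sum_range, show 4 + (K + 2) - 4 = K + 1 + 1 by omega,
    Finset.sum_range_succ, Finset.sum_range_succ']
  have h1 : ∑ x ∈ Finset.range K, rowC (K + 6) s (4 + (x + 1)) =
      ∑ x ∈ Finset.range K, seqG (s - x) := by
    apply Finset.sum_congr rfl
    intro x hx
    rw [Finset.mem_range] at hx
    rw [rowC_mid _ _ _ (by omega) (by omega)]
    congr 1; omega
  rw [h1, seqG_sum s K (by omega), Nat.add_zero, rowC_four _ _ hk,
    show 4 + (K + 1) = K + 6 - 1 by omega, rowC_last]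
  ring

lemma opD_rowC (k s i : ℕ) (hk : 7 ≤ k) (hs : s + 5 ≤ k) (h1 : 1 ≤ i) (h2 : i ≤ k - 1) :
    opD k (rowC k s) i = rowC k (s + 1) i := by
  obtain h | h | h | h | h | h | h : i = 1 ∨ i = 2 ∨ i = 3 ∨ i = 4 ∨ (i = 5) ∨
      (i = k - 1) ∨ (6 ≤ i ∧ i < k - 1) := by omega
  · subst h
    rw [rowC_one _ _ hk, ← rowC_sum k s hk (by omega)]; simp [opD]
  · subst h
    rw [rowC_two _ _ hk, seqB_succ, ← rowC_two k s hk, ← rowC_three k s hk]; simp [opD]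
  · subst h
    rw [rowC_three _ _ hk, seqC_succ, ← rowC_one k s hk]; simp [opD]
  · subst h
    rw [rowC_four _ _ hk, seqD_succ, ← rowC_one k s hk, ← rowC_two k s hk]; simp [opD]
  · subst h
    rw [rowC_mid _ _ _ (by omega) (by omega), Nat.add_sub_cancel, seqG_succ,
      ← rowC_three k s hk, ← rowC_four k s hk]
    simp [opD]
  · subst h
    simp only [opD]
    rw [if_neg (by omega), if_neg (by omega), if_neg (by omega), if_neg (by omega),
      if_neg (by omega), if_pos (by trivial), rowC_last, rowC_last,
      rowC_mid _ _ _ (by omega) (by omega), seqG_small _ (by omega)]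
    ring
  · simp only [opD]
    rw [if_neg (by omega), if_neg (by omega), if_neg (by omega), if_neg (by omega),
      if_neg (by omega), if_neg (by omega),
      rowC_mid _ _ _ (by omega) (by omega), rowC_mid _ _ _ (by omega) (by omega)]
    congr 1; omega

lemma seqA_dbl (s : ℕ) : seqA (s + 3) = 2 * seqA (s + 2) := by simp only [seqA]; ring
lemma seqB_dbl (s : ℕ) : seqB (s + 4) = 2 * seqB (s + 3) := by simp only [seqB]; ring
lemma seqC_dbl (s : ℕ) : seqC (s + 4) = 2 * seqC (s + 3) := by simp only [seqC]; ring
lemma seqD_dbl (s : ℕ) : seqD (s + 5) = 2 * seqD (s + 4) := by simp only [seqD]; ring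
lemma seqG_dbl (s : ℕ) : seqG (s + 6) = 2 * seqG (s + 5) := by simp only [seqG]; ring

lemma colX_zero (k i : ℕ) (h : i + 2 < k) : colX k i = 0 := by
  simp only [colX]; rw [if_neg (by omega), if_neg (by omega)]

lemma colY_zero (k i : ℕ) (h : i + 3 < k) : colY k i = 0 := by
  simp only [colY]; rw [if_neg (by omega), if_neg (by omega)]

lemma colX_a (k : ℕ) : colX k (k - 1) = 1 := by simp [colX]

lemma colX_b (k : ℕ) (hk : 7 ≤ k) : colX k (k - 2) = -1 := by
  simp only [colX]; rw [if_neg (by omega), if_pos (by trivial)]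

lemma colY_a (k : ℕ) (hk : 7 ≤ k) : colY k (k - 1) = 0 := by
  simp only [colY]; rw [if_neg (by omega), if_neg (by omega)]

lemma colY_b (k : ℕ) (hk : 7 ≤ k) : colY k (k - 2) = -1 := by
  simp only [colY]; rw [if_neg (by omega), if_pos (by trivial)]

lemma colY_c (k : ℕ) : colY k (k - 3) = 1 := by simp [colY]

lemma opD_top (k i : ℕ) (hk : 7 ≤ k) (h1 : 1 ≤ i) (h2 : i ≤ k - 1) :
    opD k (rowC k (k - 4)) i = 2 * rowC k (k - 4) i + colX k i + colY k i := by
  obtain ⟨K, rfl⟩ : ∃ K, k = K + 7 := ⟨k - 7, by omega⟩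
  have hK : K + 7 - 4 = K + 3 := by omega
  rw [hK]
  obtain h | h | h | h | h | h | h | h | h : i = 1 ∨ i = 2 ∨ i = 3 ∨ (i = 4) ∨ (i = 5) ∨
      (i = K + 6) ∨ (6 ≤ i ∧ i = K + 5) ∨ (6 ≤ i ∧ i = K + 4) ∨ (6 ≤ i ∧ i < K + 4) := by omega
  · subst h
    have e : opD (K + 7) (rowC (K + 7) (K + 3)) 1 = seqA (K + 3 + 1) := by
      rw [← rowC_sum (K + 7) (K + 3) hk (by omega)]; simp [opD]
    rw [e, rowC_one _ _ hk, colX_zero _ _ (by omega), colY_zero _ _ (by omega), seqA_dbl (K + 1)]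
    ring
  · subst h
    rw [rowC_two _ _ hk, colX_zero _ _ (by omega), colY_zero _ _ (by omega),
      ← seqB_dbl K, seqB_succ, ← rowC_two (K + 7) _ hk, ← rowC_three (K + 7) _ hk]; simp [opD]
  · subst h
    rw [rowC_three _ _ hk, colX_zero _ _ (by omega), colY_zero _ _ (by omega),
      ← seqC_dbl K, seqC_succ, ← rowC_one (K + 7) _ hk]; simp [opD]
  · subst h
    have e : opD (K + 7) (rowC (K + 7) (K + 3)) 4 = seqD (K + 3 + 1) := by
      rw [seqD_succ, ← rowC_one (K + 7) _ hk, ← rowC_two (K + 7) _ hk]; simp [opD]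
    rw [e, rowC_four _ _ hk]
    rcases K with _ | K
    · norm_num [colX, colY, seqD]
    · rw [colX_zero _ _ (by omega), colY_zero _ _ (by omega), seqD_dbl]; ring
  · subst h
    have e : opD (K + 7) (rowC (K + 7) (K + 3)) 5 = seqG (K + 3 + 1) := by
      rw [seqG_succ, ← rowC_three (K + 7) _ hk, ← rowC_four (K + 7) _ hk]; simp [opD]
    rw [e, rowC_mid _ _ _ (by omega) (by omega)]
    rcases K with _ | _ | K
    · norm_num [colX, colY, seqG]
    · norm_num [colX, colY, seqG]
    · rw [colX_zero _ _ (by omega), colY_zero _ _ (by omega), Nat.add_sub_cancel]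
      have := seqG_dbl K
      simpa using this
  · subst h
    have e := rowC_last (K + 7) (K + 3)
    have e2 := colX_a (K + 7)
    have e3 := colY_a (K + 7) hk
    simp only [opD]
    rw [if_neg (by omega), if_neg (by omega), if_neg (by omega), if_neg (by omega),
      if_neg (by omega), if_pos (by omega), rowC_mid _ _ (K + 7 - 2) (by omega) (by omega),
      show K + 3 + 5 - (K + 7 - 2) = 3 by omega]
    rw [show K + 7 - 1 = K + 6 by omega] at *
    rw [e, e2, e3]
    norm_num [seqG]
  all_goals
    simp only [opD]
    rw [if_neg (by omega), if_neg (by omega), if_neg (by omega), if_neg (by omega),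
      if_neg (by omega), if_neg (by omega),
      rowC_mid _ _ _ (by omega) (by omega), rowC_mid _ _ _ (by omega) (by omega)]
  · have e2 := colX_b (K + 7) hk
    have e3 := colY_b (K + 7) hk
    rw [show K + 7 - 2 = i by omega] at e2 e3
    rw [e2, e3, show K + 3 + 5 - (i - 1) = 4 by omega, show K + 3 + 5 - i = 3 by omega]
    norm_num [seqG]
  · have e3 := colY_c (K + 7)
    rw [show K + 7 - 3 = i by omega] at e3
    rw [colX_zero _ _ (by omega), e3, show K + 3 + 5 - (i - 1) = 5 by omega,
      show K + 3 + 5 - i = 4 by omega]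
    norm_num [seqG]
  · rw [colX_zero _ _ (by omega), colY_zero _ _ (by omega)]
    obtain ⟨d, hd⟩ : ∃ d, K + 3 + 5 - i = d + 5 := ⟨K + 3 - i, by omega⟩
    rw [hd, show K + 3 + 5 - (i - 1) = d + 6 by omega, seqG_dbl]
    ring

lemma opD_colX (k i : ℕ) (hk : 7 ≤ k) (h1 : 1 ≤ i) (h2 : i ≤ k - 1) : opD k (colX k) i = 0 := by
  obtain ⟨K, rfl⟩ : ∃ K, k = K + 7 := ⟨k - 7, by omega⟩
  simp only [opD]
  split_ifs with a1 a2 a3 a4 a5 a6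
  · rw [show K + 7 - 1 = K + 4 + 1 + 1 by omega, Finset.sum_Icc_succ_top (by omega),
      Finset.sum_Icc_succ_top (by omega), Finset.sum_eq_zero]
    · have e1 := colX_a (K + 7)
      have e2 := colX_b (K + 7) hk
      rw [show K + 7 - 1 = K + 4 + 1 + 1 by omega] at e1
      rw [show K + 7 - 2 = K + 4 + 1 by omega] at e2
      rw [e1, e2]; ring
    · intro l hl
      rw [Finset.mem_Icc] at hl
      exact colX_zero _ _ (by omega)
  · rw [colX_zero _ _ (by omega), colX_zero _ _ (by omega)]; ring
  · rw [colX_zero _ _ (by omega)]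
  · rw [colX_zero _ _ (by omega), colX_zero _ _ (by omega)]; ring
  · rw [colX_zero _ _ (by omega), colX_zero _ _ (by omega)]; ring
  · rw [colX_a, colX_b _ hk]; ring
  · rw [colX_zero _ _ (by omega)]

lemma opD_colY (k i : ℕ) (hk : 7 ≤ k) (h1 : 1 ≤ i) (h2 : i ≤ k - 1) :
    opD k (colY k) i = - colX k i := by
  obtain ⟨K, rfl⟩ : ∃ K, k = K + 7 := ⟨k - 7, by omega⟩
  simp only [opD]
  split_ifs with a1 a2 a3 a4 a5 a6
  · rw [show K + 7 - 1 = K + 3 + 1 + 1 + 1 by omega, Finset.sum_Icc_succ_top (by omega),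
      Finset.sum_Icc_succ_top (by omega), Finset.sum_Icc_succ_top (by omega), Finset.sum_eq_zero]
    · have e1 := colY_a (K + 7) hk
      have e2 := colY_b (K + 7) hk
      have e3 := colY_c (K + 7)
      rw [show K + 7 - 1 = K + 3 + 1 + 1 + 1 by omega] at e1
      rw [show K + 7 - 2 = K + 3 + 1 + 1 by omega] at e2
      rw [show K + 7 - 3 = K + 3 + 1 by omega] at e3
      rw [e1, e2, e3, colX_zero _ _ (by omega)]; ring
    · intro l hl
      rw [Finset.mem_Icc] at hl
      exact colY_zero _ _ (by omega)
  · rw [colY_zero _ _ (by omega), colY_zero _ _ (by omega), colX_zero _ _ (by omega)]; ring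
  · rw [colY_zero _ _ (by omega), colX_zero _ _ (by omega)]; ring
  · rw [colY_zero _ _ (by omega), colY_zero _ _ (by omega), colX_zero _ _ (by omega)]; ring
  · subst a5
    rcases K with _ | K
    · norm_num [colX, colY]
    · rw [colY_zero _ _ (by omega), colY_zero _ _ (by omega), colX_zero _ _ (by omega)]; ring
  · rw [a6, colY_a _ hk, colY_b _ hk, colX_a]; ring
  · by_cases h : i = K + 7 - 2
    · rw [h, colX_b _ hk, show K + 7 - 2 - 1 = K + 7 - 3 by omega, colY_c]; ring
    · rw [colX_zero _ _ (by omega), colY_zero _ _ (by omega)]; ring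

lemma opD_add (k : ℕ) (F G : ℕ → ℝ) (i : ℕ) :
    opD k (fun l => F l + G l) i = opD k F i + opD k G i := by
  simp only [opD]
  split_ifs
  · exact Finset.sum_add_distrib
  all_goals ring

lemma Rf_comm (k i j : ℕ) (hk : 7 ≤ k) (h1 : 1 ≤ i) (h2 : i ≤ k - 1) (h3 : 1 ≤ j)
    (h4 : j ≤ k - 1) : opD k (fun l => Rf k l j) i = opBr (Rf k i) j := by
  obtain h | h | h | h | h : j = 1 ∨ j = 2 ∨ j = 3 ∨ j = 4 ∨ 5 ≤ j := by omega
  · subst h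
    have := opD_colX k i hk h1 h2
    simpa [Rf, opBr] using this
  · subst h
    have e : (fun l => Rf k l 2) = fun l => rowC k (k - 4) l + colY k l := by
      funext l; simp [Rf]
    rw [e, opD_add, opD_top k i hk h1 h2, opD_colY k i hk h1 h2]
    simp only [opBr, Rf, show k - 1 - 3 = k - 4 by omega]
    norm_num
    ring
  · subst h
    have e : (fun l => Rf k l 3) = rowC k (k - 4) := by
      funext l; simp [Rf, show k - 1 - 3 = k - 4 by omega]
    rw [e, opD_top k i hk h1 h2]
    simp only [opBr, Rf, show k - 1 - 3 = k - 4 by omega]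
    norm_num
    ring
  · subst h
    have e : (fun l => Rf k l 4) = rowC k (k - 5) := by
      funext l; simp [Rf, show k - 1 - 4 = k - 5 by omega]
    rw [e, opD_rowC k _ i hk (by omega) h1 h2]
    simp only [opBr, Rf, show k - 5 + 1 = k - 4 by omega, show k - 1 - 3 = k - 4 by omega]
    norm_num [show k - 1 - 3 = k - 4 by omega]
  · have e : (fun l => Rf k l j) = rowC k (k - 1 - j) := by
      funext l; simp only [Rf]; rw [if_neg (by omega), if_neg (by omega)]
    rw [e, opD_rowC k _ i hk (by omega) h1 h2]
    simp only [opBr, Rf]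
    rw [if_neg (by omega), if_neg (by omega), if_neg (by omega), if_neg (by omega),
      if_neg (by omega)]
    congr 1; omega

/-- The intertwiner for `k ≥ 7`. -/
def Rm (k : ℕ) : Matrix (Fin (k - 1)) (Fin (k - 1)) ℝ :=
  Matrix.of fun i j => Rf k (i.1 + 1) (j.1 + 1)

lemma Rm_comm (k : ℕ) (hk : 7 ≤ k) :
    petrie k (cl k (deltaK k)) * Rm k = Rm k * petrie k (cl k (betaK k)) := by
  ext i j
  have hi := i.2
  have hj := j.2
  rw [Matrix.mul_apply, Matrix.mul_apply]
  simp only [Rm, Matrix.of_apply]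
  rw [delta_mul k hk (fun l => Rf k l (j.1 + 1)) i, mul_beta k hk (Rf k (i.1 + 1)) j]
  exact Rf_comm k _ _ hk (by omega) (by omega) (by omega) (by omega)

/-- Kernel of the intertwiner, for sequences extended by zero. -/
def Ker (k : ℕ) (F : ℕ → ℝ) : Prop :=
  (∀ j, k ≤ j → F j = 0) ∧ Rm k *ᵥ (fun l : Fin (k - 1) => F (l.1 + 1)) = 0

lemma Ker_step (k : ℕ) (hk : 7 ≤ k) (F : ℕ → ℝ) (h : Ker k F) : Ker k (opBc F) := by
  refine ⟨?_, ?_⟩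
  · intro j hj
    simp only [opBc]
    rw [if_neg (by omega), if_neg (by omega), if_neg (by omega)]
    exact h.1 _ (by omega)
  · have e : (fun l : Fin (k - 1) => opBc F (l.1 + 1)) =
        petrie k (cl k (betaK k)) *ᵥ (fun l : Fin (k - 1) => F (l.1 + 1)) := by
      funext l
      exact (beta_mul k hk F (h.1 k le_rfl) l).symm
    rw [e, Matrix.mulVec_mulVec, ← Rm_comm k hk, ← Matrix.mulVec_mulVec, h.2, Matrix.mulVec_zero]

lemma Ker_one (k : ℕ) (hk : 7 ≤ k) (F : ℕ → ℝ) (h : Ker k F) : - F 1 + F 2 + 2 * F 3 = 0 := by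
  have e := congrFun h.2 ⟨k - 3, by omega⟩
  simp only [Matrix.mulVec, dotProduct, Rm, Matrix.of_apply, Pi.zero_apply] at e
  rw [show k - 3 + 1 = k - 2 by omega,
    Fin.sum_univ_eq_sum_range (fun l => Rf k (k - 2) (l + 1) * F (l + 1)),
    show k - 1 = k - 4 + 1 + 1 + 1 by omega, Finset.sum_range_succ', Finset.sum_range_succ',
    Finset.sum_range_succ', Finset.sum_eq_zero] at e
  · have r1 : Rf k (k - 2) 1 = -1 := by simp [Rf, colX_b k hk]
    have r2 : Rf k (k - 2) 2 = 1 := by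
      have : Rf k (k - 2) 2 = rowC k (k - 4) (k - 2) + colY k (k - 2) := by simp [Rf]
      rw [this, colY_b k hk, rowC_mid _ _ _ (by omega) (by omega),
        show k - 4 + 5 - (k - 2) = 3 by omega]
      norm_num [seqG]
    have r3 : Rf k (k - 2) 3 = 2 := by
      have : Rf k (k - 2) 3 = rowC k (k - 1 - 3) (k - 2) := by simp [Rf]
      rw [this, rowC_mid _ _ _ (by omega) (by omega),
        show k - 1 - 3 + 5 - (k - 2) = 3 by omega]
      norm_num [seqG]
    norm_num [r1, r2, r3] at e
    linarith
  · intro x _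
    simp only [Rf]
    rw [if_neg (by omega), if_neg (by omega), rowC_mid _ _ _ (by omega) (by omega),
      seqG_small _ (by omega), zero_mul]

lemma Ker_two (k : ℕ) (hk : 7 ≤ k) (F : ℕ → ℝ) (h : Ker k F) :
    3 * F 2 + 2 * F 3 + 2 * F 4 = 0 := by
  have := Ker_one k hk _ (Ker_step k hk F h)
  norm_num [opBc] at this
  linarith

lemma Ker_three (k : ℕ) (hk : 7 ≤ k) (F : ℕ → ℝ) (h : Ker k F) :
    5 * F 2 + 5 * F 3 + 2 * F 4 + 2 * F 5 = 0 := by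
  have := Ker_two k hk _ (Ker_step k hk F h)
  norm_num [opBc] at this
  linarith

lemma Ker_four (k : ℕ) (hk : 7 ≤ k) (F : ℕ → ℝ) (h : Ker k F) :
    F 4 - 2 * F 5 + 2 * F 6 = 0 := by
  have h3 := Ker_three k hk F h
  have := Ker_three k hk _ (Ker_step k hk F h)
  norm_num [opBc] at this
  linarith

lemma Ker_rec (k : ℕ) (hk : 7 ≤ k) (r : ℕ) : ∀ F : ℕ → ℝ, Ker k F →
    F (r + 4) - 2 * F (r + 5) + 2 * F (r + 6) = 0 := by
  induction r with
  | zero => intro F h; simpa using Ker_four k hk F h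
  | succ r ih =>
    intro F h
    have := ih _ (Ker_step k hk F h)
    have e : ∀ j, opBc F (r + 4 + j) = F (r + 4 + j + 1) := by
      intro j
      simp only [opBc]
      rw [if_neg (by omega), if_neg (by omega), if_neg (by omega)]
    have e0 := e 0
    have e1 := e 1
    have e2 := e 2
    rw [show r + 5 = r + 4 + 1 by omega, show r + 6 = r + 4 + 2 by omega, e1, e2] at this
    rw [Nat.add_zero] at e0
    rw [e0] at this
    rw [show r + 1 + 4 = r + 4 + 1 by omega, show r + 1 + 5 = r + 4 + 1 + 1 by omega,
      show r + 1 + 6 = r + 4 + 2 + 1 by omega]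
    exact this

lemma Ker_tail (k : ℕ) (hk : 7 ≤ k) (F : ℕ → ℝ) (h : Ker k F) (d : ℕ) :
    ∀ j, 4 ≤ j → k ≤ j + d → F j = 0 := by
  induction d with
  | zero => intro j _ hj; exact h.1 j (by omega)
  | succ d ih =>
    intro j h4 hj
    obtain ⟨r, rfl⟩ : ∃ r, j = r + 4 := ⟨j - 4, by omega⟩
    have := Ker_rec k hk r F h
    rw [ih (r + 5) (by omega) (by omega), ih (r + 6) (by omega) (by omega)] at this
    linarith

lemma Ker_zero (k : ℕ) (hk : 7 ≤ k) (F : ℕ → ℝ) (h : Ker k F) (j : ℕ) (hj : 1 ≤ j) :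
    F j = 0 := by
  have t := fun j h4 => Ker_tail k hk F h k j h4 (by omega)
  have h1 := Ker_one k hk F h
  have h2 := Ker_two k hk F h
  have h3 := Ker_three k hk F h
  rw [t 4 (by omega)] at h2 h3
  rw [t 5 (by omega)] at h3
  obtain rfl | rfl | rfl | h4 : j = 1 ∨ j = 2 ∨ j = 3 ∨ 4 ≤ j := by omega
  · linarith
  · linarith
  · linarith
  · exact t j h4

lemma Rm_isUnit (k : ℕ) (hk : 7 ≤ k) : IsUnit (Rm k) := by
  rw [← Matrix.mulVec_injective_iff_isUnit]
  rw [← Matrix.coe_mulVecLin, ← LinearMap.ker_eq_bot, Matrix.ker_mulVecLin_eq_bot_iff]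
  intro v hv
  have hF : ∀ l : Fin (k - 1),
      (fun j : ℕ => if h : 1 ≤ j ∧ j < k then v ⟨j - 1, by omega⟩ else 0) (l.1 + 1) = v l := by
    intro l
    have := l.2
    simp only
    rw [dif_pos ⟨by omega, by omega⟩]
    congr 1
  have hK : Ker k (fun j : ℕ => if h : 1 ≤ j ∧ j < k then v ⟨j - 1, by omega⟩ else 0) := by
    refine ⟨?_, ?_⟩
    · intro j hj
      exact dif_neg (by omega)
    · rw [show (fun l : Fin (k - 1) =>
        (fun j : ℕ => if h : 1 ≤ j ∧ j < k then v ⟨j - 1, by omega⟩ else 0) (l.1 + 1)) = v from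
          funext hF]
      exact hv
  funext l
  rw [← hF l]
  exact Ker_zero k hk _ hK _ (by omega)

lemma Rf_last (k j : ℕ) (hk : 7 ≤ k) : Rf k (k - 1) j = 1 := by
  simp only [Rf, rowC_last, colX_a, colY_a k hk]
  split_ifs <;> norm_num

lemma right_generic (k : ℕ) (hk : 7 ≤ k) : RightSimilar k (betaK k) (deltaK k) := by
  refine right_of_block k (by omega) _ _ (beta_range k (by omega)) (delta_range k (by omega))
    (Rm k) (Rm_isUnit k hk) (Rm_comm k hk) ?_ ?_
  · intro i j hj
    have hi := i.2
    simp only [Rm, Matrix.of_apply, Rf]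
    rw [if_neg (by omega), if_neg (by omega), show k - 1 - (j.1 + 1) = 0 by omega]
    split_ifs with h
    · rw [show i.1 + 1 = k - 1 by omega, rowC_last]
    · simp only [rowC]
      rw [if_neg (by omega)]
      split_ifs <;> first | rfl | exact seqG_small _ (by omega)
  · intro j
    have hj := j.2
    have hd : deltaK k k = k - 1 := by
      simp only [deltaK]; rw [if_neg (by omega), if_pos (by omega)]
    have hb : betaK k k = 1 := by
      simp only [betaK]
      rw [if_neg (by omega), if_neg (by omega), if_neg (by omega), if_neg (by omega), if_pos (by trivial)]
    rw [hd, hb, if_pos (by omega), Finset.sum_eq_single ⟨k - 2, by omega⟩]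
    · simp only [Rm, Matrix.of_apply]
      rw [if_pos (by omega), show k - 2 + 1 = k - 1 by omega, Rf_last k _ hk, one_mul]
    · intro i _ hne
      have hi := i.2
      have : i.1 ≠ k - 2 := fun h => hne (Fin.ext h)
      rw [if_neg (by omega), zero_mul]
    · intro h; exact absurd (Finset.mem_univ _) h

/-- Theorem 13. -/
theorem betaK_deltaK_right_similar (k : ℕ) (hk : 5 ≤ k) :
    RightSimilar k (betaK k) (deltaK k) ∧
    ¬ LeftSimilar k (betaK k) (deltaK k) ∧
    ¬ TwoSidedSimilar k (betaK k) (deltaK k) ∧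
    (petrie k (betaK k)).trace ≠ (petrie k (deltaK k)).trace ∧
    ¬ MatSimilar (petrie k (betaK k)) (petrie k (deltaK k)) := by
  have hne : (petrie k (betaK k)).trace ≠ (petrie k (deltaK k)).trace := by
    rw [trace_beta k hk, trace_delta k hk]; norm_num
  refine ⟨?_, not_left k hk, not_twoSided k hk, hne, ?_⟩
  · obtain rfl | rfl | h : k = 5 ∨ k = 6 ∨ 7 ≤ k := by omega
    · exact right_five
    · exact right_six
    · exact right_generic k h
  · intro h
    have e := trace_eq_of_similar h
    exact hne e
end

section
/- For every integer k ≥ 4, the permutations σ_k = (3 4) (the transposition of 3 and 4) and ρ_k = (1 2)(3 4) of P_k are right weakly similar but not right similar; in particular, for every n ≥ 1 and every synchronized right extension (σ', ρ') of σ_k and ρ_k to P_{k+n}, the Petrie matrices M_{σ'} and M_{ρ'} have the same characteristic polynomial, while for some synchronized right extension the Petrie matrices are not similar over ℝ. -/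
open Matrix

/-- The transposition `(3 4)` of `P_k`. -/
def transp34 : ℕ → ℕ := fun i => if i = 3 then 4 else if i = 4 then 3 else i

/-- The permutation `(1 2)(3 4)` of `P_k`. -/
def transp12_34 : ℕ → ℕ := fun i =>
  if i = 1 then 2 else if i = 2 then 1 else if i = 3 then 4 else if i = 4 then 3 else i

/-- Adding to row `j` a multiple of a basis vector, when row `i` is a nonzero multiple of that
basis vector, does not change the determinant. -/
theorem det_eq_of_row_single {m R : Type*} [Fintype m] [DecidableEq m] [CommRing R] [IsDomain R]
    (A B : Matrix m m R) (i j a : m) (hij : i ≠ j) (c d : R) (hc : c ≠ 0)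
    (hA : A i = c • Pi.single a (1 : R)) (hB : ∀ r, r ≠ j → B r = A r)
    (hBj : B j = A j + d • Pi.single a (1 : R)) : B.det = A.det := by
  have hBA : B = A.updateRow j (A j + d • Pi.single a (1 : R)) := by
    ext r s
    by_cases h : r = j
    · subst h; rw [hBj]; simp
    · rw [hB r h]; simp [Matrix.updateRow_ne h]
  have h0 : (A.updateRow j (Pi.single a (1 : R))).det = 0 := by
    have h1 : c * (A.updateRow j (Pi.single a (1 : R))).det = 0 := by
      rw [← Matrix.det_updateRow_smul, ← hA]
      exact Matrix.det_zero_of_row_eq hij (by simp [Matrix.updateRow_ne hij])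
    exact (mul_eq_zero.mp h1).resolve_left hc
  rw [hBA, Matrix.det_updateRow_add, Matrix.det_updateRow_smul, h0, Matrix.updateRow_eq_self]
  simp

theorem charpoly_part (N : ℕ) (hN : 4 ≤ N) (σ ρ : ℕ → ℕ) (h1 : σ 1 = 1) (h2 : σ 2 = 2)
    (h3 : σ 3 = 4) (g1 : ρ 1 = 2) (g2 : ρ 2 = 1)
    (h : ∀ i, 3 ≤ i → i ≤ N → σ i = ρ i) :
    (petrie N σ).charpoly = (petrie N ρ).charpoly := by
  have g3 : ρ 3 = 4 := by rw [← h 3 le_rfl (by omega), h3]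
  symm
  unfold Matrix.charpoly
  refine det_eq_of_row_single _ _ (⟨0, by omega⟩ : Fin (N - 1)) ⟨1, by omega⟩ ⟨0, by omega⟩
    (by simp) (Polynomial.X - Polynomial.C 1) (-1) (Polynomial.X_sub_C_ne_zero 1) ?_ ?_ ?_
  · ext1 j
    by_cases hj : j = ⟨0, by omega⟩
    · subst hj
      rw [Matrix.charmatrix_apply_eq]
      simp [petrie, h1, h2]
    · rw [Matrix.charmatrix_apply_ne _ _ _ (Ne.symm hj)]
      have : j.1 ≠ 0 := fun hh => hj (Fin.ext hh)
      simp [petrie, h1, h2, hj, this]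
  · intro r hr
    have hr' : r.1 ≠ 1 := fun hh => hr (Fin.ext hh)
    have : petrie N ρ r = petrie N σ r := by
      ext j
      by_cases h0 : r.1 = 0
      · simp [petrie, h0, h1, h2, g1, g2]
      · have hlt := r.2
        simp [petrie, h (r.1 + 1) (by omega) (by omega), h (r.1 + 2) (by omega) (by omega)]
    ext1 j
    simp [Matrix.charmatrix_apply, this]
  · ext1 j
    have : petrie N ρ ⟨1, by omega⟩ j
        = petrie N σ ⟨1, by omega⟩ j + (Pi.single ⟨0, by omega⟩ (1 : ℝ) : Fin (N - 1) → ℝ) j := by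
      simp only [petrie, Matrix.of_apply, Pi.single_apply, Fin.ext_iff, h2, h3, g2, g3]
      norm_num
      split_ifs <;> first | omega | simp
    simp only [Matrix.charmatrix_apply, this, Pi.add_apply, Pi.smul_apply, Pi.single_apply]
    split_ifs <;> simp <;> ring

/-- The extension witnessing non-similarity. -/
def extW (k : ℕ) (σ : ℕ → ℕ) : ℕ → ℕ := fun i =>
  if i < k then σ i else if i = k then k + 1 else if i = k + 1 then σ k else i

theorem extW_ext (k : ℕ) (hk : 4 ≤ k) (σ : ℕ → ℕ) (hσ : σ = transp34 ∨ σ = transp12_34) :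
    IsRightExt k 2 σ (extW k σ) := by
  refine ⟨?_, ?_, k + 1, by omega, by omega, by simp [extW], ?_⟩
  · unfold IsPermOn
    have hpos : ∀ i, 1 ≤ i → i ≤ k → 1 ≤ σ i ∧ σ i ≤ k := by
      intro i h1 h2
      rcases hσ with rfl | rfl
      · simp only [transp34]; split_ifs <;> omega
      · simp only [transp12_34]; split_ifs <;> omega
    have hinj : ∀ i j, σ i = σ j → i = j := by
      intro i j hij
      rcases hσ with rfl | rfl
      · simp only [transp34] at hij; split_ifs at hij <;> omega
      · simp only [transp12_34] at hij; split_ifs at hij <;> omega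
    have hm : Set.MapsTo (extW k σ) (Set.Icc 1 (k + 2)) (Set.Icc 1 (k + 2)) := by
      intro i hi
      simp only [Set.mem_Icc] at hi ⊢
      have h1 := hpos i hi.1
      have h2 := hpos k (by omega) le_rfl
      simp only [extW]
      split_ifs <;> omega
    refine ((Set.finite_Icc 1 (k + 2)).injOn_iff_bijOn_of_mapsTo hm).mp ?_
    intro i hi j hj hij
    simp only [Set.mem_Icc] at hi hj
    have h1 := hpos i hi.1
    have h2 := hpos k (by omega) le_rfl
    have h3 := hpos j hj.1
    have h4 := hinj i j
    have h5 := hinj i k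
    have h6 := hinj k j
    simp only [extW] at hij
    split_ifs at hij <;> omega
  · intro i _ hi
    simp only [extW]
    rw [if_pos (by omega)]
  · intro j hj h1 h2
    simp only [extW]
    split_ifs <;> omega

theorem extW_agree (k : ℕ) (hk : 4 ≤ k) (i : ℕ) (hi : 3 ≤ i) :
    extW k transp34 i = extW k transp12_34 i := by
  simp only [extW, transp34, transp12_34]
  split_ifs <;> omega

theorem not_sim (k : ℕ) (hk : 4 ≤ k) :
    ¬ MatSimilar (petrie (k + 2) (extW k transp34)) (petrie (k + 2) (extW k transp12_34)) := by
  rintro ⟨P, hP, hPe⟩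
  set A := petrie (k + 2) (extW k transp34) with hA
  set B := petrie (k + 2) (extW k transp12_34) with hB
  have hPd : IsUnit P.det := (Matrix.isUnit_iff_isUnit_det P).mp hP
  have hBA : B - 1 = P * (A - 1) * P⁻¹ := by
    rw [hPe, Matrix.mul_sub, Matrix.sub_mul, Matrix.mul_one, Matrix.mul_nonsing_inv _ hPd]
  have hrank : (B - 1).rank = (A - 1).rank := by
    rw [hBA, Matrix.rank_mul_eq_left_of_isUnit_det _ _ (Matrix.isUnit_nonsing_inv_det _ hPd),
      Matrix.rank_mul_eq_right_of_isUnit_det _ _ hPd]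
  -- membership in the kernels
  have mem (M : Matrix (Fin (k + 2 - 1)) (Fin (k + 2 - 1)) ℝ) (x : Fin (k + 2 - 1) → ℝ) :
      x ∈ LinearMap.ker (M - 1).mulVecLin ↔ ∀ i, M i ⬝ᵥ x = x i := by
    rw [LinearMap.mem_ker, Matrix.mulVecLin_apply, Matrix.sub_mulVec, Matrix.one_mulVec,
      sub_eq_zero, funext_iff]
    rfl
  let f (a : ℕ) (ha : a < 5) : Fin (k + 2 - 1) := ⟨a, by omega⟩
  have rows (i : Fin (k + 2 - 1)) (hi : i.1 ≠ 1) : B i = A i := by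
    ext j
    by_cases h0 : i.1 = 0
    · have e1 : 1 < k := by omega
      have e2 : 2 < k := by omega
      have a1 : extW k transp34 1 = 1 := by simp [extW, e1, transp34]
      have a2 : extW k transp34 2 = 2 := by simp [extW, e2, transp34]
      have b1 : extW k transp12_34 1 = 2 := by simp [extW, e1, transp12_34]
      have b2 : extW k transp12_34 2 = 1 := by simp [extW, e2, transp12_34]
      simp only [hA, hB, petrie, Matrix.of_apply, h0, zero_add, a1, a2, b1, b2, min_comm, max_comm]
    · simp only [hA, hB, petrie, Matrix.of_apply, extW_agree k hk (i.1 + 1) (by omega),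
        extW_agree k hk (i.1 + 2) (by omega)]
  have h2k : 2 < k := by omega
  have h3k : 3 < k := by omega
  have A1 : A (f 1 (by omega)) = Pi.single (f 1 (by omega)) 1 + Pi.single (f 2 (by omega)) 1 := by
    ext j
    simp only [hA, petrie, Matrix.of_apply, Pi.add_apply, Pi.single_apply, Fin.ext_iff, extW, f,
      transp34]
    norm_num [h2k, h3k]
    split_ifs <;> first | omega | simp
  have B1 : B (f 1 (by omega)) = Pi.single (f 0 (by omega)) 1 + Pi.single (f 1 (by omega)) 1
      + Pi.single (f 2 (by omega)) 1 := by
    ext j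
    simp only [hB, petrie, Matrix.of_apply, Pi.add_apply, Pi.single_apply, Fin.ext_iff, extW, f,
      transp12_34]
    norm_num [h2k, h3k]
    split_ifs <;> first | omega | simp
  have key (x) (hx : ∀ i, B i ⬝ᵥ x = x i) : x (f 2 (by omega)) = 0 := by
    by_cases h5 : k = 5
    · subst h5
      have B3 : B (f 3 (by omega)) = Pi.single (f 2 (by omega)) 1 + Pi.single (f 3 (by omega)) 1
          + Pi.single (f 4 (by omega)) 1 := by
        ext j
        simp only [hB, petrie, Matrix.of_apply, Pi.add_apply, Pi.single_apply, Fin.ext_iff, extW, f,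
          transp12_34]
        norm_num
        split_ifs <;> first | omega | simp
      have B5 : B ⟨5, by omega⟩ = Pi.single (f 4 (by omega)) 1 + Pi.single ⟨5, by omega⟩ 1 := by
        ext j
        simp only [hB, petrie, Matrix.of_apply, Pi.add_apply, Pi.single_apply, Fin.ext_iff, extW, f,
          transp12_34]
        norm_num
        split_ifs <;> first | omega | simp
      have e3 := hx (f 3 (by omega))
      have e5 := hx ⟨5, by omega⟩
      rw [B3] at e3
      rw [B5] at e5
      simp only [add_dotProduct, single_dotProduct, one_mul] at e3 e5
      linarith
    · have B3 : B (f 3 (by omega)) = Pi.single (f 2 (by omega)) 1 + Pi.single (f 3 (by omega)) 1 := by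
        have v4 : extW k transp12_34 4 = 3 ∨ extW k transp12_34 4 = 5 := by
          simp only [extW, transp12_34]; split_ifs <;> omega
        have v45 : (extW k transp12_34 4 = 3 ∧ extW k transp12_34 5 = 5) ∨
            (extW k transp12_34 4 = 5 ∧ extW k transp12_34 5 = 3) := by
          by_cases h4 : k = 4
          · subst h4; simp [extW, transp12_34]
          · left
            have a : 4 < k := by omega
            have b : 5 < k := by omega
            simp [extW, transp12_34, a, b]
        ext j
        simp only [hB, petrie, Matrix.of_apply, Pi.add_apply, Pi.single_apply, Fin.ext_iff, f]
        rcases v45 with ⟨a, b⟩ | ⟨a, b⟩ <;> norm_num [a, b] <;>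
          split_ifs <;> first | omega | simp
      have e3 := hx (f 3 (by omega))
      rw [B3] at e3
      simp only [add_dotProduct, single_dotProduct, one_mul] at e3
      linarith
  have hle : LinearMap.ker (B - 1).mulVecLin ≤ LinearMap.ker (A - 1).mulVecLin := by
    intro x hx
    rw [mem] at hx ⊢
    have hk2 := key x hx
    intro i
    by_cases hi : i.1 = 1
    · have : i = f 1 (by omega) := Fin.ext hi
      rw [this, A1]
      simp only [add_dotProduct, single_dotProduct, one_mul]
      rw [hk2, add_zero]
    · rw [← rows i hi]; exact hx i
  have hfin : Module.finrank ℝ (LinearMap.ker (B - 1).mulVecLin)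
      = Module.finrank ℝ (LinearMap.ker (A - 1).mulVecLin) := by
    have e1 := LinearMap.finrank_range_add_finrank_ker (A - 1).mulVecLin
    have e2 := LinearMap.finrank_range_add_finrank_ker (B - 1).mulVecLin
    unfold Matrix.rank at hrank
    omega
  have heq := Submodule.eq_of_le_of_finrank_eq hle hfin
  have hin : Pi.single (f 0 (by omega)) (1 : ℝ) ∈ LinearMap.ker (A - 1).mulVecLin := by
    rw [mem]
    intro i
    rw [dotProduct_single, mul_one]
    simp only [Pi.single_apply, Fin.ext_iff, hA, petrie, Matrix.of_apply, f]
    refine if_congr ?_ rfl rfl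
    simp only [extW, transp34]
    constructor
    · intro h
      by_contra hne
      have := h.1
      split_ifs at this <;> omega
    · intro h
      rw [h]
      norm_num [h2k, (by omega : 1 < k)]
  rw [← heq, mem] at hin
  have := hin (f 1 (by omega))
  rw [B1] at this
  simp [f] at this

theorem transp34_right_weakly_similar_not_right_similar (k : ℕ) (hk : 4 ≤ k) :
    RightWeaklySimilar k transp34 transp12_34 ∧ ¬ RightSimilar k transp34 transp12_34 := by
  constructor
  · intro n hn σ' ρ' ⟨⟨_, hσ, _⟩, ⟨_, hρ, _⟩, t, ht1, ht2, hst, hrt, hag⟩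
    refine charpoly_part (k + n) (by omega) σ' ρ' ?_ ?_ ?_ ?_ ?_ ?_
    · rw [hσ 1 (by omega) (by omega)]; rfl
    · rw [hσ 2 (by omega) (by omega)]; rfl
    · rw [hσ 3 (by omega) (by omega)]; rfl
    · rw [hρ 1 (by omega) (by omega)]; rfl
    · rw [hρ 2 (by omega) (by omega)]; rfl
    · have ag (i : ℕ) (hi : 3 ≤ i) : transp34 i = transp12_34 i := by
        simp only [transp34, transp12_34]; split_ifs <;> omega
      intro i hi hi2
      by_cases h : i ≤ k - 1
      · rw [hσ i (by omega) h, hρ i (by omega) h, ag i hi]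
      · by_cases hit : i = t
        · rw [hit, hst, hrt, ag k (by omega)]
        · exact hag i hit (by omega) hi2
  · intro h
    refine not_sim k hk (h 2 (by omega) _ _ ⟨extW_ext k hk _ (Or.inl rfl),
      extW_ext k hk _ (Or.inr rfl), k + 1, by omega, by omega, by simp [extW], by simp [extW], ?_⟩)
    intro i _ hi _
    exact extW_agree k hk i (by omega)
end
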